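/- arXiv:2506.00529 — 2 statements merged into one kernel-verified Lean document; each statement's English description precedes it below -/
import Mathlib

section
/- Let R be a commutative Noetherian ring, r ≥ 1 an integer, I_1,…,I_r ideals of R, and N ⊆ M finitely generated R-modules. Let f : K → L be an R-linear map between finitely generated R-modules and let F denote the associated coherent functor, F(X) := Hom_R(K,X) / {g ∘ f : g ∈ Hom_R(L,X)}. Then the set of associated primes Ass_R(F(M/I^n N)) stabilizes: there exists c ∈ ℕ^r such that Ass_R(F(M/I^n N)) = Ass_R(F(M/I^c N)) for all n ≥ c. -/
/-- The value of the coherent functor presented by `f : K →ₗ[R] L` on a module `X`: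
`F(X) = Hom_R(K, X) / {g ∘ f : g ∈ Hom_R(L, X)}`. -/
abbrev coherentApply {R K L : Type*} [CommRing R] [AddCommGroup K] [Module R K]
    [AddCommGroup L] [Module R L] (f : K →ₗ[R] L)
    (X : Type*) [AddCommGroup X] [Module R X] : Type _ :=
  (K →ₗ[R] X) ⧸ LinearMap.range (LinearMap.lcomp R X f)

/-- The product ideal `I^n = I_1^{n_1} ⋯ I_r^{n_r}`. -/
abbrev prodPow {R : Type*} [CommRing R] {r : ℕ} (I : Fin r → Ideal R)
    (n : Fin r → ℕ) : Ideal R :=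
  ∏ i, I i ^ n i


namespace AssStab

section PP
variable {R : Type*} [CommRing R] {r : ℕ} (I : Fin r → Ideal R)

lemma pp_zero : prodPow I 0 = ⊤ := by simp [prodPow, Ideal.one_eq_top]

lemma pp_add (m n : Fin r → ℕ) : prodPow I (m + n) = prodPow I m * prodPow I n := by
  simp [prodPow, pow_add, Finset.prod_mul_distrib]

lemma pp_single (i : Fin r) : prodPow I (Pi.single i 1) = I i := by
  unfold prodPow
  rw [Finset.prod_eq_single i]
  · simp
  · intro b _ hb
    simp [Pi.single_eq_of_ne hb]
  · simp

lemma pp_add_smul {E : Type*} [AddCommGroup E] [Module R E] (m n : Fin r → ℕ)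
    (N : Submodule R E) :
    prodPow I (m + n) • N = prodPow I m • (prodPow I n • N) := by
  rw [pp_add, Submodule.mul_smul]

lemma pp_smul_le {E : Type*} [AddCommGroup E] [Module R E] (m : Fin r → ℕ)
    (N : Submodule R E) : prodPow I m • N ≤ N := Submodule.smul_le_right

lemma pp_anti {m n : Fin r → ℕ} (h : m ≤ n) : prodPow I n ≤ prodPow I m := by
  obtain ⟨k, rfl⟩ := exists_add_of_le h
  rw [pp_add]; exact Ideal.mul_le_inf.trans inf_le_left

end PP

section ACC
variable {R : Type*} [CommRing R] {r : ℕ} (I : Fin r → Ideal R)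
variable {E : Type*} [AddCommGroup E] [Module R E]

/-- Rees families of submodules. -/
structure IsRees (N : (Fin r → ℕ) → Submodule R E) : Prop where
  smul_le : ∀ m n : Fin r → ℕ, prodPow I m • N n ≤ N (m + n)
  le : ∀ n : Fin r → ℕ, N n ≤ prodPow I n • (⊤ : Submodule R E)

/-- The map from the polynomial ring onto the Rees algebra. -/
noncomputable def psi {σ : Type*} (g : σ → R) (d : σ → Fin r) :
    MvPolynomial σ R →ₐ[R] MvPolynomial (Fin r) R :=
  MvPolynomial.aeval (fun s => MvPolynomial.monomial (Finsupp.single (d s) 1) (g s))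

/-- Ideal of coefficients in a given degree. -/
noncomputable def coefId {σ : Type*} (g : σ → R) (d : σ → Fin r) (n : Fin r →₀ ℕ) : Ideal R :=
  Submodule.comap (MvPolynomial.monomial n) (LinearMap.range (psi g d).toLinearMap)

lemma coefId_mul {σ : Type*} (g : σ → R) (d : σ → Fin r) (m n : Fin r →₀ ℕ) :
    coefId g d m * coefId g d n ≤ coefId g d (m + n) := by
  rw [Ideal.mul_le]
  rintro a ⟨F, hF⟩ b ⟨G, hG⟩
  refine ⟨F * G, ?_⟩
  simp only [AlgHom.toLinearMap_apply] at hF hG ⊢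
  rw [map_mul, hF, hG, MvPolynomial.monomial_mul]

lemma coefId_zero {σ : Type*} (g : σ → R) (d : σ → Fin r) : coefId g d 0 = ⊤ := by
  rw [Ideal.eq_top_iff_one]
  exact ⟨1, by simp⟩

lemma coefId_pow {σ : Type*} (g : σ → R) (d : σ → Fin r) (i : Fin r) (J : Ideal R)
    (hJ : J ≤ coefId g d (Finsupp.single i 1)) (k : ℕ) :
    J ^ k ≤ coefId g d (Finsupp.single i k) := by
  induction k with
  | zero => simp [coefId_zero]
  | succ k ih =>
    rw [pow_succ, Finsupp.single_add]
    exact (Ideal.mul_mono ih hJ).trans (coefId_mul g d _ _)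

lemma coefId_prod {σ : Type*} (g : σ → R) (d : σ → Fin r)
    (hJ : ∀ i, I i ≤ coefId g d (Finsupp.single i 1)) (n : Fin r →₀ ℕ) (s : Finset (Fin r)) :
    ∏ i ∈ s, I i ^ n i ≤ coefId g d (∑ i ∈ s, Finsupp.single i (n i)) := by
  classical
  induction s using Finset.induction_on with
  | empty => simp [coefId_zero]
  | insert a s ha ih =>
    rw [Finset.prod_insert ha, Finset.sum_insert ha]
    exact (Ideal.mul_mono (coefId_pow g d a _ (hJ a) _) ih).trans (coefId_mul g d _ _)

lemma pp_le_coefId {σ : Type*} (g : σ → R) (d : σ → Fin r)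
    (hJ : ∀ i, I i ≤ coefId g d (Finsupp.single i 1)) (n : Fin r →₀ ℕ) :
    prodPow I n ≤ coefId g d n := by
  have := coefId_prod I g d hJ n Finset.univ
  rwa [Finsupp.univ_sum_single] at this

/-- Evaluate in a degree. -/
noncomputable def ev {σ : Type*} (g : σ → R) (d : σ → Fin r) {k : ℕ} (q : Fin k → E)
    (n : Fin r →₀ ℕ) : (Fin k → MvPolynomial σ R) →ₗ[R] E :=
  ∑ j, (LinearMap.toSpanSingleton R E (q j)) ∘ₗ (MvPolynomial.lcoeff R n) ∘ₗ
    (psi g d).toLinearMap ∘ₗ (LinearMap.proj j)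

lemma ev_apply {σ : Type*} (g : σ → R) (d : σ → Fin r) {k : ℕ} (q : Fin k → E)
    (n : Fin r →₀ ℕ) (F : Fin k → MvPolynomial σ R) :
    ev g d q n F = ∑ j, (psi g d (F j)).coeff n • q j := by
  simp [ev]

lemma ev_X {σ : Type*} (g : σ → R) (d : σ → Fin r) {k : ℕ} (q : Fin k → E)
    (n : Fin r →₀ ℕ) (F : Fin k → MvPolynomial σ R) (s : σ) :
    ev g d q n ((MvPolynomial.X s : MvPolynomial σ R) • F) =
      if Finsupp.single (d s) 1 ≤ n then g s • ev g d q (n - Finsupp.single (d s) 1) F else 0 := by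
  classical
  simp only [ev_apply, Pi.smul_apply, smul_eq_mul, map_mul]
  simp only [psi, MvPolynomial.aeval_X, MvPolynomial.coeff_monomial_mul']
  split_ifs with h
  · simp [Finset.smul_sum, mul_smul]
  · simp

/-- The submodule over the polynomial ring attached to a Rees family. -/
noncomputable def bigSub {σ : Type*} (g : σ → R) (d : σ → Fin r) (hg : ∀ s, g s ∈ I (d s))
    {k : ℕ} (q : Fin k → E) (N : (Fin r → ℕ) → Submodule R E) (hN : IsRees I N) :
    Submodule (MvPolynomial σ R) (Fin k → MvPolynomial σ R) where
  carrier := {F | ∀ n : Fin r →₀ ℕ, ev g d q n F ∈ N n}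
  add_mem' := by
    intro a b ha hb n
    rw [map_add]; exact add_mem (ha n) (hb n)
  zero_mem' := by
    intro n
    rw [map_zero]; exact zero_mem _
  smul_mem' := by
    intro c
    induction c using MvPolynomial.induction_on with
    | C a =>
      intro F hF n
      have : (MvPolynomial.C a : MvPolynomial σ R) • F = a • F := by
        ext j : 1
        simp [MvPolynomial.C_mul']
      rw [this, map_smul]
      exact Submodule.smul_mem _ _ (hF n)
    | add p q hp hq =>
      intro F hF n
      rw [add_smul, map_add]
      exact add_mem (hp hF n) (hq hF n)
    | mul_X p s hp =>
      intro F hF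
      rw [mul_smul]
      apply hp
      intro n
      rw [ev_X]
      split_ifs with h
      · have h1 := hF (n - Finsupp.single (d s) 1)
        have h2 := hN.smul_le (Pi.single (d s) 1) (⇑(n - Finsupp.single (d s) (1:ℕ)))
        rw [pp_single] at h2
        have h3 := h2 (Submodule.smul_mem_smul (hg s) h1)
        have h4 : (Pi.single (d s) 1 + ⇑(n - Finsupp.single (d s) 1 : Fin r →₀ ℕ) : Fin r → ℕ) = ⇑n := by
          rw [← Finsupp.single_eq_pi_single, ← Finsupp.coe_add, add_tsub_cancel_of_le h]
        rwa [h4] at h3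
      · exact zero_mem _

theorem rees_wf [IsNoetherianRing R] [Module.Finite R E] :
    WellFoundedGT {N : (Fin r → ℕ) → Submodule R E // IsRees I N} := by
  classical
  have hfg : ∀ i, ∃ s : Finset R, Ideal.span (s : Set R) = I i := fun i =>
    (isNoetherianRing_iff_ideal_fg R).1 inferInstance (I i)
  choose s hs using hfg
  obtain ⟨k, q, hq⟩ := Module.Finite.exists_fin (R := R) (M := E)
  let σ := Σ i : Fin r, {x // x ∈ s i}
  let g : σ → R := fun x => x.2.1
  let d : σ → Fin r := fun x => x.1
  have hg : ∀ x, g x ∈ I (d x) := by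
    rintro ⟨i, x, hx⟩
    rw [← hs]
    exact Ideal.subset_span hx
  have hJ : ∀ i, I i ≤ coefId g d (Finsupp.single i 1) := by
    intro i
    rw [← hs i, Ideal.span_le]
    intro x hx
    exact ⟨MvPolynomial.X (⟨i, x, hx⟩ : σ), by simp [psi, g, d]⟩
  let Φ : {N : (Fin r → ℕ) → Submodule R E // IsRees I N} →
      Submodule (MvPolynomial σ R) (Fin k → MvPolynomial σ R) :=
    fun N => bigSub I g d hg q N.1 N.2
  have hle : ∀ A B, Φ A ≤ Φ B → A ≤ B := by
    intro A B h n y hy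
    have hy' := A.2.le n hy
    rw [← hq, Submodule.mem_ideal_smul_span_iff_exists_sum] at hy'
    obtain ⟨a, ha, hsum⟩ := hy'
    let n' : Fin r →₀ ℕ := Finsupp.equivFunOnFinite.symm n
    have hn' : ⇑n' = n := by simp [n']
    have hc : ∀ j, ∃ F, psi g d F = MvPolynomial.monomial n' (a j) := by
      intro j
      have := pp_le_coefId I g d hJ n' (by rw [hn']; exact ha j)
      exact this
    choose F hF using hc
    have key : ∀ m, ev g d q m F = if n' = m then y else 0 := by
      intro m
      rw [ev_apply]
      simp only [hF, MvPolynomial.coeff_monomial]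
      split_ifs with h
      · rw [← hsum, Finsupp.sum_fintype]
        simp
      · simp
    have hFA : F ∈ Φ A := by
      intro m
      rw [key]
      split_ifs with h
      · rw [← h, hn']; exact hy
      · exact zero_mem _
    have := h hFA n'
    rw [key, if_pos rfl, hn'] at this
    exact this
  have hmono : StrictMono Φ := by
    intro A B h
    refine lt_of_le_not_ge ?_ fun h' => ?_
    · intro F hF n
      exact h.le n (hF n)
    · exact not_le_of_gt h (hle _ _ h')
  exact hmono.wellFoundedGT

end ACC

section AR
variable {R : Type*} [CommRing R] [IsNoetherianRing R] {r : ℕ} (I : Fin r → Ideal R)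
variable {E : Type*} [AddCommGroup E] [Module R E] [Module.Finite R E]

theorem rees_stable (N : (Fin r → ℕ) → Submodule R E) (hN : IsRees I N) :
    ∃ c, ∀ n, N (n + c) = prodPow I n • N c := by
  let G : (Fin r → ℕ) → (Fin r → ℕ) → Submodule R E := fun c m =>
    ⨆ (k : Fin r → ℕ) (_ : k ≤ c) (l : Fin r → ℕ) (_ : l + k = m), prodPow I l • N k
  have hG : ∀ c, IsRees I (G c) := by
    intro c
    constructor
    · intro m n
      simp only [G, Submodule.smul_iSup]
      refine iSup_le fun k => iSup_le fun hk => iSup_le fun l => iSup_le fun hl => ?_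
      rw [← pp_add_smul]
      exact le_iSup_of_le k (le_iSup_of_le hk (le_iSup_of_le (m + l)
        (le_iSup_of_le (by rw [← hl, add_assoc]) le_rfl)))
    · intro n
      refine iSup_le fun k => iSup_le fun hk => iSup_le fun l => iSup_le fun hl => ?_
      rw [← hl, pp_add_smul]
      exact Submodule.smul_mono le_rfl (hN.le k)
  have hmono : ∀ c c', c ≤ c' → G c ≤ G c' := by
    intro c c' h m
    refine iSup_le fun k => iSup_le fun hk => iSup_le fun l => iSup_le fun hl => ?_
    exact le_iSup_of_le k (le_iSup_of_le (hk.trans h) (le_iSup_of_le l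
        (le_iSup_of_le hl le_rfl)))
  have := rees_wf I (E := E)
  let S : Set {N : (Fin r → ℕ) → Submodule R E // IsRees I N} :=
    Set.range fun c => ⟨G c, hG c⟩
  obtain ⟨M, ⟨c, rfl⟩, hmax⟩ := WellFounded.has_min
    (wellFounded_gt (α := {N : (Fin r → ℕ) → Submodule R E // IsRees I N})) S ⟨_, ⟨0, rfl⟩⟩
  refine ⟨c, fun n => le_antisymm ?_ (hN.smul_le _ _)⟩
  have h1 : G (c ⊔ (n + c)) ≤ G c := by
    by_contra h
    refine hmax ⟨G (c ⊔ (n + c)), hG _⟩ ⟨_, rfl⟩ ?_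
    exact lt_of_le_not_ge (hmono _ _ le_sup_left) h
  have h2 : N (n + c) ≤ G (c ⊔ (n + c)) (n + c) := by
    refine le_iSup_of_le (n + c) (le_iSup_of_le le_sup_right (le_iSup_of_le 0
        (le_iSup_of_le (zero_add _) ?_)))
    rw [pp_zero, Submodule.top_smul]
  refine (h2.trans (h1 _)).trans ?_
  refine iSup_le fun k => iSup_le fun hk => iSup_le fun l => iSup_le fun hl => ?_
  obtain ⟨e, rfl⟩ := exists_add_of_le hk
  have : l = n + e := by
    apply add_right_cancel (b := k)
    rw [hl]; abel
  rw [this, pp_add_smul, add_comm k e]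
  exact Submodule.smul_mono le_rfl (hN.smul_le _ _)

theorem artin_rees (W Q : Submodule R E) :
    ∃ c, ∀ n, W ⊓ prodPow I (n + c) • Q = prodPow I n • (W ⊓ prodPow I c • Q) := by
  refine rees_stable I (fun n => W ⊓ prodPow I n • Q) ⟨fun m n => ?_, fun n => ?_⟩
  · refine le_inf ((pp_smul_le I _ _).trans inf_le_left) ?_
    rw [pp_add_smul]
    exact Submodule.smul_mono le_rfl inf_le_right
  · exact inf_le_right.trans (Submodule.smul_mono le_rfl le_top)

/-- Relative associated primes. -/
def AssR (A B : Submodule R E) : Set (Ideal R) :=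
  {p | p.IsPrime ∧ ∃ x ∈ A, ∀ a : R, a • x ∈ B ↔ a ∈ p}

lemma assR_union (A B B' : Submodule R E) (h : B ≤ B') :
    AssR A B ⊆ AssR B' B ∪ AssR A B' := by
  rintro p ⟨hp, x, hx, hxa⟩
  by_cases hc : ∃ a, a ∉ p ∧ a • x ∈ B'
  · obtain ⟨a, ha, hax⟩ := hc
    refine Or.inl ⟨hp, a • x, hax, fun b => ?_⟩
    rw [← mul_smul, hxa]
    exact ⟨fun h => (hp.mem_or_mem h).resolve_right ha, fun h => Ideal.mul_mem_right _ _ h⟩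
  · push Not at hc
    refine Or.inr ⟨hp, x, hx, fun b => ⟨fun hb => ?_, fun hb => h ((hxa b).2 hb)⟩⟩
    by_contra hbp
    exact hc b hbp hb

theorem ass_finite (A B : (Fin r → ℕ) → Submodule R E) (hA : IsRees I A) (hB : IsRees I B) :
    (⋃ n, AssR (A n) (B n)).Finite := by
  have := rees_wf I (E := E)
  suffices H : ∀ C : {N : (Fin r → ℕ) → Submodule R E // IsRees I N},
      (⋃ n, AssR (A n) (C.1 n)).Finite from H ⟨B, hB⟩
  intro C
  induction C using WellFoundedGT.induction with
  | ind C ih =>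
  obtain ⟨B, hB⟩ := C
  let S : Set (Ideal R) := {J | ∃ n, ∃ x ∈ A n, x ∉ B n ∧ ∀ a : R, a • x ∈ B n ↔ a ∈ J}
  by_cases hS : S.Nonempty
  · obtain ⟨p, ⟨n, x, hxA, hxB, hxp⟩, hmax⟩ :=
      set_has_maximal_iff_noetherian.2 (inferInstance : IsNoetherian R R) S hS
    let B' : (Fin r → ℕ) → Submodule R E := fun m =>
      B m ⊔ ⨆ (k : Fin r → ℕ) (_ : k + n = m), prodPow I k • Submodule.span R {x}
    have hxn : Submodule.span R {x} ≤ A n := by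
      rw [Submodule.span_le]; simpa using hxA
    have hB' : IsRees I B' := by
      constructor
      · intro m l
        simp only [B', Submodule.smul_sup, Submodule.smul_iSup]
        refine sup_le_sup (hB.smul_le _ _) (iSup_le fun k => iSup_le fun hk => ?_)
        rw [← pp_add_smul]
        exact le_iSup_of_le (m + k) (le_iSup_of_le (by rw [← hk, add_assoc]) le_rfl)
      · intro m
        refine sup_le (hB.le m) (iSup_le fun k => iSup_le fun hk => ?_)
        rw [← hk, pp_add_smul]
        exact Submodule.smul_mono le_rfl (hxn.trans (hA.le n))
    have hlt : (⟨B, hB⟩ : {N : (Fin r → ℕ) → Submodule R E // IsRees I N}) < ⟨B', hB'⟩ := by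
      refine lt_of_le_not_ge (fun m => le_sup_left) fun h => hxB (h n ?_)
      refine Submodule.mem_sup_right ?_
      have : Submodule.span R {x} ≤
          ⨆ (k : Fin r → ℕ) (_ : k + n = n), prodPow I k • Submodule.span R {x} := by
        refine le_iSup_of_le 0 (le_iSup_of_le (zero_add _) ?_)
        rw [pp_zero, Submodule.top_smul]
      exact this (Submodule.mem_span_singleton_self x)
    refine ((ih ⟨B', hB'⟩ hlt).union (Set.finite_singleton p)).subset ?_
    refine Set.iUnion_subset fun m => (assR_union (A m) (B m) (B' m) le_sup_left).trans ?_
    refine Set.union_subset ?_ ((Set.subset_iUnion (fun n => AssR (A n) (B' n)) m).trans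
      Set.subset_union_left)
    rintro q ⟨hq, y, hy, hyq⟩
    refine Or.inr ?_
    obtain ⟨b, hb, z, hz, rfl⟩ := Submodule.mem_sup.1 hy
    have hzq : ∀ a : R, a • z ∈ B m ↔ a ∈ q := by
      intro a
      rw [← hyq, smul_add]
      exact (Submodule.add_mem_iff_right _ (Submodule.smul_mem _ _ hb)).symm
    have hzB : z ∉ B m := by
      intro h
      exact hq.ne_top ((Ideal.eq_top_iff_one _).2 ((hzq 1).1 (by simpa using h)))
    have hzA : z ∈ A m := by
      refine (iSup_le fun k => iSup_le fun hk => ?_ : (⨆ (k : Fin r → ℕ) (_ : k + n = m),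
        prodPow I k • Submodule.span R {x}) ≤ A m) hz
      rw [← hk]
      exact (Submodule.smul_mono le_rfl hxn).trans (hA.smul_le _ _)
    have hpq : p ≤ q := by
      intro a ha
      rw [← hzq]
      have : (⨆ (k : Fin r → ℕ) (_ : k + n = m), prodPow I k • Submodule.span R {x}) ≤
          (B m).comap (LinearMap.lsmul R E a) := by
        refine iSup_le fun k => iSup_le fun hk => ?_
        rw [← Submodule.map_le_iff_le_comap, Submodule.map_smul'', ← hk]
        refine (Submodule.smul_mono le_rfl ?_).trans (hB.smul_le _ _)
        rw [Submodule.map_span_le]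
        intro w hw
        rw [Set.mem_singleton_iff.1 hw]
        exact (hxp a).2 ha
      exact this hz
    by_contra hne
    exact hmax q ⟨m, z, hzA, hzB, hzq⟩ (lt_of_le_of_ne hpq fun h => hne h.symm)
  · convert Set.finite_empty
    rw [Set.eq_empty_iff_forall_notMem]
    intro p hp
    obtain ⟨n, hp, x, hx, hxp⟩ := Set.mem_iUnion.1 hp
    refine hS ⟨p, n, x, hx, fun h => ?_, hxp⟩
    exact hp.ne_top ((Ideal.eq_top_iff_one _).2 ((hxp 1).1 (by simpa using h)))

lemma ass_top_finite (Z : Submodule R E) : (AssR ⊤ Z).Finite := by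
  have hr : ∀ N : Submodule R E, IsRees (Fin.elim0 : Fin 0 → Ideal R) (fun _ => N) := fun N =>
    ⟨fun m n => pp_smul_le _ _ _, fun n => by simp [prodPow, Ideal.one_eq_top]⟩
  have := ass_finite (Fin.elim0 : Fin 0 → Ideal R) (fun _ => ⊤) (fun _ => Z) (hr _) (hr _)
  exact this.subset (Set.subset_iUnion (fun _ : Fin 0 → ℕ => AssR ⊤ Z) 0)

lemma ass_pow_finite (Z : Submodule R E) : (⋃ n, AssR ⊤ (prodPow I n • Z)).Finite := by
  have h1 : ∀ i : Fin r,
      (⋃ n, AssR (prodPow I n • Z) (prodPow I (Pi.single i 1 + n) • Z)).Finite := by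
    intro i
    refine ass_finite I (fun n => prodPow I n • Z) (fun n => prodPow I (Pi.single i 1 + n) • Z)
      ⟨fun m n => ?_, fun n => ?_⟩ ⟨fun m n => ?_, fun n => ?_⟩
    · rw [pp_add_smul]
    · exact Submodule.smul_mono le_rfl le_top
    · rw [← pp_add_smul, add_left_comm]
    · rw [add_comm, pp_add_smul]
      exact Submodule.smul_mono le_rfl le_top
  refine ((ass_top_finite Z).union (Set.finite_iUnion h1)).subset ?_
  refine Set.iUnion_subset fun n => ?_
  induction hs : ∑ i, n i generalizing n with
  | zero =>
    have : n = 0 := by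
      ext i
      simpa using (Finset.sum_eq_zero_iff.1 hs) i (Finset.mem_univ i)
    rw [this, pp_zero, Submodule.top_smul]
    exact Set.subset_union_left
  | succ s ih =>
    obtain ⟨i, hi⟩ : ∃ i, n i ≠ 0 := by
      by_contra! h
      simp [h] at hs
    have hle : Pi.single i 1 ≤ n := by
      intro j
      by_cases hj : j = i
      · subst hj; simp; omega
      · simp [Pi.single_eq_of_ne hj]
    obtain ⟨m, rfl⟩ := exists_add_of_le hle
    have hm : ∑ i, m i = s := by
      simp [Finset.sum_add_distrib] at hs
      omega
    refine (assR_union _ _ (prodPow I m • Z) ?_).trans (Set.union_subset ?_ (ih m hm))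
    · rw [pp_add_smul]; exact pp_smul_le _ _ _
    · intro q hq
      exact Or.inr (Set.mem_iUnion.2 ⟨i, Set.mem_iUnion.2 ⟨m, hq⟩⟩)

lemma ass_sup_pow_finite (W Z : Submodule R E) :
    (⋃ n, AssR ⊤ (W ⊔ prodPow I n • Z)).Finite := by
  refine (ass_pow_finite I (Z.map W.mkQ)).subset (Set.iUnion_mono fun n => ?_)
  rintro p ⟨hp, x, -, hx⟩
  refine ⟨hp, W.mkQ x, trivial, fun a => ?_⟩
  rw [← hx, ← map_smul, ← Submodule.map_smul'', ← Submodule.mem_comap, Submodule.comap_map_mkQ]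

end AR

section TameSec
variable {R : Type*} [CommRing R] {r : ℕ} (I : Fin r → Ideal R)
variable {E' : Type*} [AddCommGroup E'] [Module R E']
variable {E : Type*} [AddCommGroup E] [Module R E]

/-- Families eventually of the form `U + I^n V`. -/
def Tame (A : (Fin r → ℕ) → Submodule R E) : Prop :=
  ∃ c, ∃ U V : Submodule R E, ∀ n, A (n + c) = U ⊔ prodPow I n • V

variable {I}

lemma Tame.shift {A : (Fin r → ℕ) → Submodule R E} {c : Fin r → ℕ} {U V : Submodule R E}
    (h : ∀ n, A (n + c) = U ⊔ prodPow I n • V) (d n : Fin r → ℕ) :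
    A (n + (d + c)) = U ⊔ prodPow I n • (prodPow I d • V) := by
  rw [← add_assoc, h, pp_add_smul]

lemma Tame.pow (V : Submodule R E) : Tame I (fun n => prodPow I n • V) :=
  ⟨0, ⊥, V, fun n => by simp⟩

lemma Tame.map {A : (Fin r → ℕ) → Submodule R E} (h : Tame I A) (g : E →ₗ[R] E') :
    Tame I (fun n => (A n).map g) := by
  obtain ⟨c, U, V, h⟩ := h
  refine ⟨c, U.map g, V.map g, fun n => ?_⟩
  simp only [h, Submodule.map_sup, Submodule.map_smul'']

lemma Tame.common {A B : (Fin r → ℕ) → Submodule R E} (hA : Tame I A) (hB : Tame I B) :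
    ∃ c, ∃ U V U' V' : Submodule R E, (∀ n, A (n + c) = U ⊔ prodPow I n • V) ∧
      (∀ n, B (n + c) = U' ⊔ prodPow I n • V') := by
  obtain ⟨c, U, V, hA⟩ := hA
  obtain ⟨c', U', V', hB⟩ := hB
  refine ⟨c' + c, U, prodPow I c' • V, U', prodPow I c • V', Tame.shift hA c', fun n => ?_⟩
  rw [add_comm c' c]
  exact Tame.shift hB c n

lemma Tame.sup {A B : (Fin r → ℕ) → Submodule R E} (hA : Tame I A) (hB : Tame I B) :
    Tame I (fun n => A n ⊔ B n) := by
  obtain ⟨c, U, V, U', V', hA, hB⟩ := Tame.common hA hB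
  refine ⟨c, U ⊔ U', V ⊔ V', fun n => ?_⟩
  simp only [hA, hB, Submodule.smul_sup]
  exact sup_sup_sup_comm _ _ _ _

lemma Tame.comap [IsNoetherianRing R] [Module.Finite R E'] {A : (Fin r → ℕ) → Submodule R E'}
    (h : Tame I A) (g : E →ₗ[R] E') :
    Tame I (fun n => (A n).comap g) := by
  obtain ⟨c, U, V, h⟩ := h
  obtain ⟨d, hd⟩ := artin_rees I (LinearMap.range g ⊔ U) V
  set T := (LinearMap.range g ⊔ U) ⊓ prodPow I d • V with hT
  refine ⟨d + c, U.comap g, (U ⊔ T).comap g, fun n => ?_⟩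
  simp only [← add_assoc, h]
  apply le_antisymm
  · intro x hx
    obtain ⟨u, hu, v, hv, huv⟩ := Submodule.mem_sup.1 (Submodule.mem_comap.1 hx)
    have hvT : v ∈ prodPow I n • T := by
      rw [← hd]
      refine ⟨?_, hv⟩
      have : v = g x + (-u) := by rw [← huv]; abel
      rw [this]
      exact Submodule.add_mem_sup ⟨x, rfl⟩ (neg_mem hu)
    have hTle : T ≤ ((U ⊔ T).comap g).map g ⊔ U := by
      intro t ht
      obtain ⟨_, ⟨y, rfl⟩, w, hw, hyw⟩ := Submodule.mem_sup.1 ht.1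
      rw [← hyw]
      refine Submodule.add_mem_sup ⟨y, ?_, rfl⟩ hw
      have : g y = -w + t := by rw [← hyw]; abel
      change g y ∈ U ⊔ T
      rw [this]
      exact Submodule.add_mem_sup (neg_mem hw) ht
    have h2 : prodPow I n • T ≤ (prodPow I n • (U ⊔ T).comap g).map g ⊔ U := by
      refine (Submodule.smul_mono le_rfl hTle).trans ?_
      rw [Submodule.smul_sup, Submodule.map_smul'']
      exact sup_le_sup le_rfl (pp_smul_le _ _ _)
    obtain ⟨_, ⟨y, hy, rfl⟩, w, hw, hyw⟩ := Submodule.mem_sup.1 (h2 hvT)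
    have : x = (x - y) + y := by abel
    rw [this]
    refine Submodule.add_mem_sup ?_ hy
    rw [Submodule.mem_comap, map_sub, ← huv, ← hyw]
    have : u + (g y + w) - g y = u + w := by abel
    rw [this]
    exact add_mem hu hw
  · refine sup_le (Submodule.comap_mono le_sup_left) ?_
    rw [← Submodule.map_le_iff_le_comap, Submodule.map_smul'']
    refine (Submodule.smul_mono le_rfl (Submodule.map_comap_le _ _)).trans ?_
    rw [Submodule.smul_sup, pp_add_smul]
    exact sup_le_sup (pp_smul_le _ _ _) (Submodule.smul_mono le_rfl inf_le_right)

lemma Tame.inf [IsNoetherianRing R] [Module.Finite R E] {A B : (Fin r → ℕ) → Submodule R E}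
    (hA : Tame I A) (hB : Tame I B) : Tame I (fun n => A n ⊓ B n) := by
  have h := Tame.comap ((hA.map (LinearMap.inl R E E)).sup (hB.map (LinearMap.inr R E E)))
    (LinearMap.prod LinearMap.id LinearMap.id)
  convert h using 2 with n
  ext x
  simp only [Submodule.mem_inf, Submodule.mem_comap, Submodule.mem_sup, Submodule.mem_map]
  constructor
  · rintro ⟨ha, hb⟩
    exact ⟨_, ⟨x, ha, rfl⟩, _, ⟨x, hb, rfl⟩, by simp⟩
  · rintro ⟨_, ⟨a, ha, rfl⟩, _, ⟨b, hb, rfl⟩, hab⟩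
    simp at hab
    obtain ⟨rfl, h⟩ := hab
    subst h
    exact ⟨ha, hb⟩

lemma Tame.iInf [IsNoetherianRing R] [Module.Finite R E] {ι : Type*} [Finite ι]
    {A : ι → (Fin r → ℕ) → Submodule R E}
    (hA : ∀ i, Tame I (A i)) : Tame I (fun n => ⨅ i, A i n) := by
  classical
  cases nonempty_fintype ι
  have : ∀ s : Finset ι, Tame I (fun n => ⨅ i ∈ s, A i n) := by
    intro s
    induction s using Finset.induction_on with
    | empty => exact ⟨0, ⊤, ⊥, fun n => by simp⟩
    | insert a s ha ih =>
      simp only [Finset.iInf_insert]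
      exact (hA a).inf ih
  simpa using this Finset.univ

open Filter in
/-- Main stabilization statement. -/
theorem tame_stab [IsNoetherianRing R] [Module.Finite R E] {A B : (Fin r → ℕ) → Submodule R E}
    (hA : Tame I A) (hB : Tame I B) :
    ∃ c, ∀ n, c ≤ n → AssR (A n) (B n) = AssR (A c) (B c) := by
  -- each prime is eventually in, or eventually out
  have key : ∀ p : Ideal R, (∀ᶠ n in atTop, p ∈ AssR (A n) (B n)) ∨
      (∀ᶠ n in atTop, p ∉ AssR (A n) (B n)) := by
    intro p
    by_cases hp : p.IsPrime
    swap
    · exact Or.inr (Eventually.of_forall fun n h => hp h.1)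
    obtain ⟨s, hs⟩ := (isNoetherianRing_iff_ideal_fg R).1 inferInstance p
    let G : (Fin r → ℕ) → Submodule R E := fun n =>
      A n ⊓ ⨅ a : {x // x ∈ s}, (B n).comap (LinearMap.lsmul R E a.1)
    have hG : Tame I G := hA.inf (Tame.iInf fun a => hB.comap _)
    have hGmem : ∀ n x, x ∈ G n ↔ x ∈ A n ∧ ∀ a ∈ p, a • x ∈ B n := by
      intro n x
      simp only [G, Submodule.mem_inf, Submodule.mem_iInf, Submodule.mem_comap,
        LinearMap.lsmul_apply, Subtype.forall]
      refine and_congr_right fun _ => ⟨fun h a ha => ?_, fun h a ha => h a ?_⟩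
      · have : p ≤ (B n).colon {x} := by
          rw [← hs]
          refine Ideal.span_le.2 fun b hb => ?_
          exact Submodule.mem_colon_singleton.2 (h b hb)
        exact Submodule.mem_colon_singleton.1 (this ha)
      · rw [← hs]; exact Ideal.subset_span ha
    have hnot : ∀ n, p ∉ AssR (A n) (B n) ↔
        ∃ t, t ∉ p ∧ G n ≤ (B n).comap (LinearMap.lsmul R E t) := by
      intro n
      constructor
      · intro h
        have h1 : ∀ x ∈ G n, ∃ t, t ∉ p ∧ t • x ∈ B n := by
          intro x hx
          by_contra! hc
          rw [hGmem] at hx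
          refine h ⟨hp, x, hx.1, fun a => ⟨fun ha => ?_, hx.2 a⟩⟩
          by_contra hap
          exact hc a hap ha
        obtain ⟨v, hv⟩ := (IsNoetherian.noetherian (G n) : (G n).FG)
        have h2 : ∀ x : {x // x ∈ v}, ∃ t, t ∉ p ∧ t • x.1 ∈ B n := fun x =>
          h1 x (by rw [← hv]; exact Submodule.subset_span x.2)
        choose t ht htB using h2
        refine ⟨∏ x, t x, fun hmem => ?_, ?_⟩
        · obtain ⟨x, -, hx⟩ := (hp.prod_mem_iff).1 hmem
          exact ht x hx
        · rw [← hv, Submodule.span_le]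
          intro x hx
          change (∏ x, t x) • x ∈ B n
          classical
          rw [← Finset.prod_erase_mul _ _ (Finset.mem_univ (⟨x, hx⟩ : {x // x ∈ v})), mul_smul]
          exact Submodule.smul_mem _ _ (htB ⟨x, hx⟩)
      · rintro ⟨t, ht, hle⟩ ⟨_, x, hx, hxp⟩
        exact ht ((hxp t).1 (hle ((hGmem n x).2 ⟨hx, fun a ha => (hxp a).2 ha⟩)))
    obtain ⟨c, U, V, W, Z, hG', hB'⟩ := Tame.common hG hB
    let Q1 : (Fin r → ℕ) → Prop := fun n =>
      ∃ t, t ∉ p ∧ U ≤ (W ⊔ prodPow I n • Z).comap (LinearMap.lsmul R E t)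
    let Q2 : (Fin r → ℕ) → Prop := fun n =>
      ∃ t, t ∉ p ∧ prodPow I n • V ≤ (W ⊔ prodPow I n • Z).comap (LinearMap.lsmul R E t)
    have hQ : ∀ n, p ∉ AssR (A (n + c)) (B (n + c)) ↔ Q1 n ∧ Q2 n := by
      intro n
      rw [hnot, hG', hB']
      constructor
      · rintro ⟨t, ht, h⟩
        exact ⟨⟨t, ht, le_sup_left.trans h⟩, ⟨t, ht, le_sup_right.trans h⟩⟩
      · rintro ⟨⟨t, ht, h⟩, ⟨t', ht', h'⟩⟩
        refine ⟨t * t', fun hm => (hp.mem_or_mem hm).elim ht ht', sup_le ?_ ?_⟩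
        · intro x hx
          change (t * t') • x ∈ W ⊔ prodPow I n • Z
          rw [mul_comm, mul_smul]
          exact Submodule.smul_mem _ _ (h hx)
        · intro x hx
          change (t * t') • x ∈ W ⊔ prodPow I n • Z
          rw [mul_smul]
          exact Submodule.smul_mem _ _ (h' hx)
    have hQ1 : ∀ m n, Q1 (m + n) → Q1 n := by
      rintro m n ⟨t, ht, h⟩
      refine ⟨t, ht, h.trans (Submodule.comap_mono (sup_le_sup le_rfl ?_))⟩
      rw [pp_add_smul]; exact pp_smul_le _ _ _
    have hQ2 : ∀ m n, Q2 n → Q2 (m + n) := by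
      rintro m n ⟨t, ht, h⟩
      refine ⟨t, ht, ?_⟩
      rw [← Submodule.map_le_iff_le_comap] at h ⊢
      rw [pp_add_smul, pp_add_smul, Submodule.map_smul'']
      refine (Submodule.smul_mono le_rfl h).trans ?_
      rw [Submodule.smul_sup]
      exact sup_le_sup (pp_smul_le _ _ _) le_rfl
    have hev : ∀ (d : Fin r → ℕ) (P : (Fin r → ℕ) → Prop), (∀ m, P (m + d + c)) →
        ∀ᶠ n in atTop, P n := by
      intro d P h
      refine eventually_atTop.2 ⟨d + c, fun n hn => ?_⟩
      obtain ⟨m, rfl⟩ := exists_add_of_le hn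
      have := h m
      rwa [add_assoc, add_comm] at this
    by_cases h1 : ∀ n, Q1 n
    · by_cases h2 : ∃ n, Q2 n
      · obtain ⟨d, hd⟩ := h2
        exact Or.inr (hev d _ fun m => (hQ _).2 ⟨h1 _, hQ2 m d hd⟩)
      · refine Or.inl (hev 0 _ fun m => ?_)
        by_contra hm
        exact h2 ⟨_, ((hQ _).1 hm).2⟩
    · push Not at h1
      obtain ⟨d, hd⟩ := h1
      refine Or.inl (hev d _ fun m => ?_)
      by_contra hm
      exact hd (hQ1 m d ((hQ _).1 hm).1)
  obtain ⟨c, W, Z, hBc⟩ := hB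
  have hfin := ass_sup_pow_finite I W Z
  set S := ⋃ n, AssR ⊤ (W ⊔ prodPow I n • Z) with hS
  have hsub : ∀ᶠ n in atTop, AssR (A n) (B n) ⊆ S := by
    refine eventually_atTop.2 ⟨c, fun n hn => ?_⟩
    obtain ⟨m, rfl⟩ := exists_add_of_le hn
    rw [add_comm, hBc]
    rintro p ⟨hp, x, -, hx⟩
    exact Set.mem_iUnion.2 ⟨m, hp, x, trivial, hx⟩
  have hall : ∀ᶠ n in atTop, ∀ p ∈ S, (p ∈ AssR (A n) (B n) ↔
      ∀ᶠ n in atTop, p ∈ AssR (A n) (B n)) := by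
    rw [Filter.eventually_all_finite hfin]
    intro p _
    rcases key p with h | h
    · filter_upwards [h] with n hn
      exact ⟨fun _ => h, fun _ => hn⟩
    · filter_upwards [h] with n hn
      refine ⟨fun h' => absurd h' hn, fun h' => ?_⟩
      obtain ⟨m, hm1, hm2⟩ := (h.and h').exists
      exact absurd hm2 hm1
  obtain ⟨c, hc⟩ := eventually_atTop.1 (hsub.and hall)
  refine ⟨c, fun n hn => ?_⟩
  ext p
  by_cases hpS : p ∈ S
  · rw [(hc n hn).2 p hpS, (hc c le_rfl).2 p hpS]
  · exact ⟨fun h => absurd ((hc n hn).1 h) hpS, fun h => absurd ((hc c le_rfl).1 h) hpS⟩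

end TameSec

section Coh
variable {R : Type*} [CommRing R]
variable {M : Type*} [AddCommGroup M] [Module R M]
variable {L : Type*} [AddCommGroup L] [Module R L]

/-- The evaluation of a relation. -/
noncomputable def relMap {b : ℕ} (ρ : Fin b → R) : (Fin b → M) →ₗ[R] M :=
  ∑ j, ρ j • LinearMap.proj j

lemma relMap_apply {b : ℕ} (ρ : Fin b → R) (m : Fin b → M) :
    relMap ρ m = ∑ j, ρ j • m j := by simp [relMap]

lemma hom_iff {b : ℕ} (l : Fin b → L) (hl : Submodule.span R (Set.range l) = ⊤)
    (s : Finset (Fin b → R))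
    (hs : Submodule.span R (s : Set (Fin b → R)) =
      LinearMap.ker (Fintype.linearCombination R l))
    (X : Submodule R M) (m : Fin b → M) :
    m ∈ (⨅ ρ : {x // x ∈ s}, X.comap (relMap ρ.1)) ↔
      ∃ h : L →ₗ[R] (M ⧸ X), ∀ j, h (l j) = X.mkQ (m j) := by
  have hsurj : Function.Surjective (Fintype.linearCombination R l) := by
    rw [← LinearMap.range_eq_top, Fintype.range_linearCombination, hl]
  simp only [Submodule.mem_iInf, Submodule.mem_comap, Subtype.forall]
  constructor
  · intro H
    let τ : (Fin b → R) →ₗ[R] (M ⧸ X) := Fintype.linearCombination R (fun j => X.mkQ (m j))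
    have hτ : LinearMap.ker (Fintype.linearCombination R l) ≤ LinearMap.ker τ := by
      rw [← hs, Submodule.span_le]
      intro ρ hρ
      have := H ρ hρ
      rw [← Submodule.ker_mkQ X, LinearMap.mem_ker, relMap_apply] at this
      simp only [SetLike.mem_coe, LinearMap.mem_ker, τ, Fintype.linearCombination_apply]
      simpa using this
    let e := LinearMap.quotKerEquivOfSurjective _ hsurj
    refine ⟨(Submodule.liftQ _ τ hτ) ∘ₗ e.symm.toLinearMap, fun j => ?_⟩
    have h1 : e (Submodule.Quotient.mk (Pi.single j 1)) = l j := by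
      change Fintype.linearCombination R l (Pi.single j 1) = l j
      simp [Fintype.linearCombination_apply_single]
    have h2 : e.symm (l j) = Submodule.Quotient.mk (Pi.single j 1) := by
      rw [← h1, LinearEquiv.symm_apply_apply]
    simp only [LinearMap.comp_apply, LinearEquiv.coe_coe, h2]
    change τ (Pi.single j 1) = _
    simp [τ, Fintype.linearCombination_apply_single]
  · rintro ⟨h, hh⟩ ρ hρ
    have h0 : Fintype.linearCombination R l ρ = 0 := by
      rw [← LinearMap.mem_ker, ← hs]; exact Submodule.subset_span hρ
    rw [← Submodule.ker_mkQ X, LinearMap.mem_ker, relMap_apply]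
    rw [Fintype.linearCombination_apply] at h0
    have := congrArg h h0
    simpa [hh] using this

end Coh

end AssStab

/-- asymptotic stability of `Ass_R (F(M / I^n N))`. -/
theorem stmt0 {R : Type*} [CommRing R] [IsNoetherianRing R]
    {r : ℕ} (hr : 1 ≤ r) (I : Fin r → Ideal R)
    (M : Type*) [AddCommGroup M] [Module R M] [Module.Finite R M]
    (N : Submodule R M)
    {K L : Type*} [AddCommGroup K] [Module R K] [Module.Finite R K]
    [AddCommGroup L] [Module R L] [Module.Finite R L]
    (f : K →ₗ[R] L) :
    ∃ c : Fin r → ℕ, ∀ n : Fin r → ℕ, c ≤ n →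
      associatedPrimes R (coherentApply f (M ⧸ (prodPow I n • N : Submodule R M))) =
      associatedPrimes R (coherentApply f (M ⧸ (prodPow I c • N : Submodule R M))) := by
  classical
  obtain ⟨a, k, hk⟩ := Module.Finite.exists_fin (R := R) (M := K)
  obtain ⟨b, l, hl⟩ := Module.Finite.exists_fin (R := R) (M := L)
  obtain ⟨s, hs⟩ := (IsNoetherian.noetherian (LinearMap.ker (Fintype.linearCombination R k)) :
    (LinearMap.ker (Fintype.linearCombination R k)).FG)
  obtain ⟨t, ht⟩ := (IsNoetherian.noetherian (LinearMap.ker (Fintype.linearCombination R l)) :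
    (LinearMap.ker (Fintype.linearCombination R l)).FG)
  have hψ : ∀ j, ∃ c : Fin b → R, Fintype.linearCombination R l c = f (k j) := by
    intro j
    have : f (k j) ∈ LinearMap.range (Fintype.linearCombination R l) := by
      rw [Fintype.range_linearCombination, hl]; trivial
    exact this
  choose ψ hψ using hψ
  let A : (Fin r → ℕ) → Submodule R (Fin a → M) := fun n =>
    ⨅ ρ : {x // x ∈ s}, (prodPow I n • N).comap (AssStab.relMap ρ.1)
  let AL : (Fin r → ℕ) → Submodule R (Fin b → M) := fun n =>
    ⨅ ρ : {x // x ∈ t}, (prodPow I n • N).comap (AssStab.relMap ρ.1)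
  let B : (Fin r → ℕ) → Submodule R (Fin a → M) := fun n =>
    (AL n).map (LinearMap.pi fun j => AssStab.relMap (ψ j)) ⊔
      ⨅ j : Fin a, (prodPow I n • N).comap (LinearMap.proj j)
  have hA : AssStab.Tame I A := AssStab.Tame.iInf fun ρ => (AssStab.Tame.pow N).comap _
  have hAL : AssStab.Tame I AL := AssStab.Tame.iInf fun ρ => (AssStab.Tame.pow N).comap _
  have hB : AssStab.Tame I B :=
    (hAL.map _).sup (AssStab.Tame.iInf fun j => (AssStab.Tame.pow N).comap _)
  have hBmem : ∀ n m, m ∈ B n ↔ ∃ g : L →ₗ[R] (M ⧸ (prodPow I n • N : Submodule R M)),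
      ∀ j, g (f (k j)) = (prodPow I n • N).mkQ (m j) := by
    intro n m
    constructor
    · intro hm
      obtain ⟨_, ⟨y, hy, rfl⟩, z, hz, rfl⟩ := Submodule.mem_sup.1 hm
      obtain ⟨g, hg⟩ := (AssStab.hom_iff l hl t ht _ y).1 hy
      refine ⟨g, fun j => ?_⟩
      have hz' : (prodPow I n • N).mkQ (z j) = 0 := by
        rw [← LinearMap.mem_ker, Submodule.ker_mkQ]
        exact (Submodule.mem_iInf _).1 hz j
      rw [Pi.add_apply, map_add, hz', add_zero, ← hψ, Fintype.linearCombination_apply,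
        LinearMap.pi_apply, AssStab.relMap_apply, map_sum, map_sum]
      simp only [map_smul, hg]
    · rintro ⟨g, hg⟩
      choose y hy using fun j => (prodPow I n • N).mkQ_surjective (g (l j))
      have hyA : y ∈ AL n := (AssStab.hom_iff l hl t ht _ y).2 ⟨g, fun j => (hy j).symm⟩
      have hm : m = (LinearMap.pi fun j => AssStab.relMap (ψ j)) y +
          (m - (LinearMap.pi fun j => AssStab.relMap (ψ j)) y) := by abel
      rw [hm]
      refine Submodule.add_mem_sup ⟨y, hyA, rfl⟩ ?_
      rw [Submodule.mem_iInf]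
      intro j
      rw [Submodule.mem_comap, ← Submodule.ker_mkQ (prodPow I n • N), LinearMap.mem_ker,
        LinearMap.proj_apply, Pi.sub_apply, map_sub, ← hg, ← hψ,
        Fintype.linearCombination_apply, LinearMap.pi_apply, AssStab.relMap_apply, map_sum,
        map_sum]
      simp only [map_smul, hy, sub_self]
  have hAss : ∀ n, associatedPrimes R (coherentApply f (M ⧸ (prodPow I n • N : Submodule R M))) =
      AssStab.AssR (A n) (B n) := by
    intro n
    have hcong : ∀ (h : K →ₗ[R] (M ⧸ (prodPow I n • N : Submodule R M))) (m : Fin a → M),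
        (∀ j, h (k j) = (prodPow I n • N).mkQ (m j)) → ∀ c : R,
        (c • m ∈ B n ↔ c • (Submodule.Quotient.mk h :
          coherentApply f (M ⧸ (prodPow I n • N : Submodule R M))) = 0) := by
      intro h m hm c
      rw [hBmem, ← Submodule.Quotient.mk_smul, Submodule.Quotient.mk_eq_zero]
      refine exists_congr fun g => ⟨fun H => ?_, fun H j => ?_⟩
      · refine LinearMap.ext_on_range hk fun j => ?_
        simp only [LinearMap.lcomp_apply, LinearMap.smul_apply, H j, hm, Pi.smul_apply, map_smul]
      · have := LinearMap.congr_fun H (k j)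
        simpa only [LinearMap.lcomp_apply, LinearMap.smul_apply, hm, Pi.smul_apply,
          map_smul] using this
    ext p
    rw [AssociatedPrimes.mem_iff, IsAssociatedPrime, Submodule.isAssociatedPrime_iff]
    refine and_congr_right fun _ => ⟨?_, ?_⟩
    · rintro ⟨x, hx⟩
      obtain ⟨h, rfl⟩ := Submodule.Quotient.mk_surjective _ x
      choose m hm using fun j => (prodPow I n • N).mkQ_surjective (h (k j))
      refine ⟨m, (AssStab.hom_iff k hk s hs _ m).2 ⟨h, fun j => (hm j).symm⟩, fun c => ?_⟩
      rw [hcong h m (fun j => (hm j).symm) c, hx, Submodule.mem_colon_singleton,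
        Submodule.mem_bot]
    · rintro ⟨m, hmA, hmp⟩
      obtain ⟨h, hh⟩ := (AssStab.hom_iff k hk s hs _ m).1 hmA
      refine ⟨Submodule.Quotient.mk h, ?_⟩
      ext c
      rw [← hmp, hcong h m hh c, Submodule.mem_colon_singleton, Submodule.mem_bot]
  obtain ⟨c, hc⟩ := AssStab.tame_stab hA hB
  refine ⟨c, fun n hn => ?_⟩
  rw [hAss, hAss, hc n hn]
end

section
/- Let R be a commutative Noetherian ring, r ≥ 1 an integer, I_1,…,I_r ideals of R, and N ⊆ M finitely generated R-modules. Let f : K → L be an R-linear map between finitely generated R-modules and let F denote the associated coherent functor, F(X) := Hom_R(K,X) / {g ∘ f : g ∈ Hom_R(L,X)}. If the length λ_R(F(M/I^n N)) is finite for all n ≫ 0, then there exist c ∈ ℕ^r and a polynomial P ∈ ℚ[x_1,…,x_r] such that λ_R(F(M/I^n N)) = P(n) for all n ≥ c. -/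
/-- The length `λ_R(X)` of an `R`-module `X`, as the supremum of lengths of chains
of submodules of `X` (an element of `WithBot ℕ∞`; it is `⊤` iff `X` has infinite
length). -/
noncomputable def moduleLength (R X : Type*) [CommRing R] [AddCommGroup X]
    [Module R X] : WithBot ℕ∞ :=
  Order.krullDim (Submodule R X)

/-! ### Eventually polynomial functions -/

/-- `h` agrees with a polynomial for all large arguments. -/
def EvPoly {r : ℕ} (h : (Fin r → ℕ) → ℚ) : Prop :=
  ∃ (c : Fin r → ℕ) (P : MvPolynomial (Fin r) ℚ), ∀ n, c ≤ n →
    h n = MvPolynomial.eval (fun i => (n i : ℚ)) P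

theorem EvPoly.add {r : ℕ} {h g : (Fin r → ℕ) → ℚ} (hh : EvPoly h) (hg : EvPoly g) :
    EvPoly (fun n => h n + g n) := by
  obtain ⟨c, P, hP⟩ := hh
  obtain ⟨d, Q, hQ⟩ := hg
  refine ⟨c ⊔ d, P + Q, fun n hn => ?_⟩
  simp only
  rw [map_add, hP n (le_trans le_sup_left hn), hQ n (le_trans le_sup_right hn)]

theorem EvPoly.sub {r : ℕ} {h g : (Fin r → ℕ) → ℚ} (hh : EvPoly h) (hg : EvPoly g) :
    EvPoly (fun n => h n - g n) := by
  obtain ⟨c, P, hP⟩ := hh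
  obtain ⟨d, Q, hQ⟩ := hg
  refine ⟨c ⊔ d, P - Q, fun n hn => ?_⟩
  simp only
  rw [map_sub, hP n (le_trans le_sup_left hn), hQ n (le_trans le_sup_right hn)]

theorem EvPoly.congr {r : ℕ} {h g : (Fin r → ℕ) → ℚ} (hh : EvPoly h) (d : Fin r → ℕ)
    (hg : ∀ n, d ≤ n → g n = h n) : EvPoly g := by
  obtain ⟨c, P, hP⟩ := hh
  refine ⟨c ⊔ d, P, fun n hn => ?_⟩
  rw [hg n (le_trans le_sup_right hn), hP n (le_trans le_sup_left hn)]

theorem EvPoly.unshift {r : ℕ} {h : (Fin r → ℕ) → ℚ} (d : Fin r → ℕ)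
    (hh : EvPoly (fun n => h (d + n))) : EvPoly h := by
  obtain ⟨c, P, hP⟩ := hh
  refine ⟨d + c, MvPolynomial.bind₁ (fun i => MvPolynomial.X i - MvPolynomial.C (d i : ℚ)) P,
    fun n hn => ?_⟩
  obtain ⟨m, rfl⟩ := exists_add_of_le hn
  have := hP (c + m) (by simp)
  simp only at this
  rw [← add_assoc] at this
  rw [this]
  simp only [MvPolynomial.eval]
  rw [MvPolynomial.eval₂Hom_bind₁]
  congr 2
  ext i
  simp
  ring

theorem exists_antideriv {r : ℕ} (i : Fin r) (Q : MvPolynomial (Fin r) ℚ) :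
    ∃ P : MvPolynomial (Fin r) ℚ, ∀ x : Fin r → ℚ,
      MvPolynomial.eval (x + Pi.single i 1) P - MvPolynomial.eval x P
        = MvPolynomial.eval x Q := by
  induction Q using MvPolynomial.induction_on' with
  | add p q hp hq =>
    obtain ⟨P, hP⟩ := hp
    obtain ⟨Q, hQ⟩ := hq
    refine ⟨P + Q, fun x => ?_⟩
    rw [map_add, map_add, map_add, ← hP, ← hQ]
    ring
  | monomial u a =>
    let B : Polynomial ℚ := Polynomial.bernoulli (u i + 1)
    refine ⟨MvPolynomial.monomial (u.erase i) (a / (u i + 1)) *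
      Polynomial.aeval (MvPolynomial.X i) B, fun x => ?_⟩
    have h1 : ∀ y : Fin r → ℚ, MvPolynomial.eval y (Polynomial.aeval (MvPolynomial.X i) B)
        = B.eval (y i) := by
      intro y
      have := Polynomial.aeval_algHom_apply (MvPolynomial.aeval y : MvPolynomial (Fin r) ℚ →ₐ[ℚ] ℚ)
        (MvPolynomial.X i) B
      simp only [MvPolynomial.aeval_X] at this
      rw [MvPolynomial.aeval_eq_eval] at this
      simpa using this.symm
    have h2 : MvPolynomial.eval (x + Pi.single i 1)
        (MvPolynomial.monomial (u.erase i) (a / (u i + 1))) =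
        MvPolynomial.eval x (MvPolynomial.monomial (u.erase i) (a / (u i + 1))) := by
      rw [MvPolynomial.eval_monomial, MvPolynomial.eval_monomial]
      congr 1
      apply Finsupp.prod_congr
      intro j hj
      have : j ≠ i := by
        rintro rfl
        simp at hj
      simp [this]
    have h3 := Polynomial.bernoulli_eval_one_add (u i + 1) (x i)
    have h4 : MvPolynomial.eval x (MvPolynomial.monomial u a) =
        a * (x i ^ u i * (u.erase i).prod fun j k => x j ^ k) := by
      rw [MvPolynomial.eval_monomial]
      congr 1
      exact (Finsupp.mul_prod_erase' u i _ (by simp)).symm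
    rw [map_mul, map_mul, h2, h1, h1, h4, MvPolynomial.eval_monomial]
    simp only [Pi.add_apply, Pi.single_eq_same, B]
    rw [add_comm (x i) 1, h3]
    have : ((u i : ℚ) + 1) ≠ 0 := by positivity
    push_cast
    field_simp
    ring

theorem eq_update_of_invariant {r : ℕ} (g : (Fin r → ℕ) → ℚ) (c : Fin r → ℕ) (i : Fin r)
    (hg : ∀ n, c ≤ n → g (n + Pi.single i 1) = g n) (k : ℕ) (y : Fin r → ℕ) (hy : c ≤ y)
    (hk : y i = c i + k) : g y = g (Function.update y i (c i)) := by
  induction k generalizing y with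
  | zero =>
    congr 1
    ext j
    by_cases hj : j = i
    · subst hj; simp [hk]
    · simp [hj]
  | succ k ih =>
    have e : y = Function.update y i (c i + k) + Pi.single i 1 := by
      ext j
      by_cases hj : j = i
      · subst hj; simp [hk]; ring
      · simp [hj]
    have hle : c ≤ Function.update y i (c i + k) := by
      intro j
      by_cases hj : j = i
      · subst hj; simp
      · simpa [hj] using hy j
    have := ih (Function.update y i (c i + k)) hle (by simp)
    rw [Function.update_idem] at this
    rw [← this]
    conv_lhs => rw [e]
    exact hg _ hle

theorem evPoly_of_diff {r : ℕ} (h : (Fin r → ℕ) → ℚ)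
    (hd : ∀ i, EvPoly (fun n => h (n + Pi.single i 1) - h n)) : EvPoly h := by
  choose c' Q hQ using hd
  let c : Fin r → ℕ := Finset.univ.sup c'
  have hc : ∀ i, c' i ≤ c := fun i => Finset.le_sup (f := c') (Finset.mem_univ i)
  have key : ∀ T : Finset (Fin r), ∃ P : MvPolynomial (Fin r) ℚ, ∀ n, c ≤ n →
      h n = MvPolynomial.eval (fun i => (n i : ℚ)) P + h (T.piecewise c n) := by
    intro T
    induction T using Finset.induction_on with
    | empty => exact ⟨0, fun n _ => by simp⟩
    | insert i T hi ih =>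
      obtain ⟨P, hP⟩ := ih
      obtain ⟨A, hA⟩ := exists_antideriv i (Q i)
      let σ : Finset (Fin r) → MvPolynomial (Fin r) ℚ := fun T =>
        MvPolynomial.bind₁ (T.piecewise (fun j => MvPolynomial.C (c j : ℚ)) MvPolynomial.X) A
      have hσ : ∀ T n, MvPolynomial.eval (fun j => (n j : ℚ)) (σ T) =
          MvPolynomial.eval (fun j => ((T.piecewise c n j : ℕ) : ℚ)) A := by
        intro T n
        simp only [σ]
        rw [MvPolynomial.eval, MvPolynomial.eval₂Hom_bind₁]
        congr 2
        ext j
        by_cases hj : j ∈ T <;> simp [hj]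
      refine ⟨P + σ T - σ (insert i T), fun n hn => ?_⟩
      have hy : c ≤ T.piecewise c n := by
        intro j
        by_cases hj : j ∈ T
        · simp [hj]
        · simpa [hj] using hn j
      obtain ⟨k, hk⟩ := exists_add_of_le (hy i)
      have := eq_update_of_invariant
        (fun n => h n - MvPolynomial.eval (fun j => (n j : ℚ)) A) c i (by
          intro m hm
          have h1 := hQ i m (le_trans (hc i) hm)
          have h2 := hA (fun j => (m j : ℚ))
          have h3 : (fun j => ((m + Pi.single i 1 : Fin r → ℕ) j : ℚ)) =
            (fun j => (m j : ℚ)) + Pi.single i 1 := by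
            ext j
            by_cases hj : j = i
            · subst hj; simp
            · simp [hj]
          simp only at h1 ⊢
          rw [h3]
          linarith) k _ hy hk
      rw [hP n hn, map_sub, map_add, hσ, hσ]
      rw [Finset.piecewise_insert]
      linarith
  obtain ⟨P, hP⟩ := key Finset.univ
  refine ⟨c, P + MvPolynomial.C (h c), fun n hn => ?_⟩
  rw [hP n hn]
  simp

/-! ### Relative length -/

/-- The length of `A / B` for submodules `B ≤ A`. -/
noncomputable def relLen {R E : Type*} [CommRing R] [AddCommGroup E] [Module R E]
    (B A : Submodule R E) : ℕ∞ :=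
  Module.length R (A ⧸ B.submoduleOf A)

section relLen
variable {R E E' : Type*} [CommRing R] [AddCommGroup E] [Module R E]
  [AddCommGroup E'] [Module R E']

theorem relLen_eq_length {X : Type*} [AddCommGroup X] [Module R X] {A B : Submodule R E}
    (g : A →ₗ[R] X) (hg : Function.Surjective g) (hk : ∀ x : A, g x = 0 ↔ (x : E) ∈ B) :
    relLen B A = Module.length R X := by
  have hker : LinearMap.ker g = B.submoduleOf A := by
    ext x
    rw [LinearMap.mem_ker, hk, Submodule.submoduleOf, Submodule.mem_comap, Submodule.subtype_apply]
  rw [relLen, ← hker]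
  exact (g.quotKerEquivOfSurjective hg).length_eq

theorem relLen_transfer (h : E →ₗ[R] E') {A B : Submodule R E} {A' B' : Submodule R E'}
    (h1 : ∀ x ∈ A, h x ∈ A') (h2 : ∀ y ∈ A', ∃ x ∈ A, y - h x ∈ B')
    (h3 : ∀ x ∈ A, h x ∈ B' ↔ x ∈ B) : relLen B A = relLen B' A' := by
  refine relLen_eq_length ((B'.submoduleOf A').mkQ ∘ₗ h.restrict h1) ?_ ?_
  · intro y
    obtain ⟨y, rfl⟩ := Submodule.mkQ_surjective _ y
    obtain ⟨x, hx, hxy⟩ := h2 y y.2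
    refine ⟨⟨x, hx⟩, ?_⟩
    rw [LinearMap.comp_apply, eq_comm, ← sub_eq_zero, ← map_sub, Submodule.mkQ_apply,
      Submodule.Quotient.mk_eq_zero]
    exact hxy
  · intro x
    rw [LinearMap.comp_apply, Submodule.mkQ_apply, Submodule.Quotient.mk_eq_zero]
    exact h3 x x.2

theorem relLen_add {A B C : Submodule R E} (h1 : B ≤ C) (h2 : C ≤ A) :
    relLen B A = relLen B C + relLen C A := by
  have hm : B.submoduleOf C ≤ (B.submoduleOf A).comap (Submodule.inclusion h2) := by
    intro x hx; exact hx
  have hm2 : B.submoduleOf A ≤ (C.submoduleOf A).comap LinearMap.id := by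
    intro x hx; exact h1 hx
  refine Module.length_eq_add_of_exact (Submodule.mapQ _ _ (Submodule.inclusion h2) hm)
    (Submodule.mapQ _ _ LinearMap.id hm2) ?_ ?_ ?_
  · rw [injective_iff_map_eq_zero]
    intro x
    obtain ⟨x, rfl⟩ := Submodule.mkQ_surjective _ x
    intro hx
    rw [Submodule.mkQ_apply, Submodule.mapQ_apply, Submodule.Quotient.mk_eq_zero] at hx
    rw [Submodule.mkQ_apply, Submodule.Quotient.mk_eq_zero]
    exact hx
  · intro x
    obtain ⟨x, rfl⟩ := Submodule.mkQ_surjective _ x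
    exact ⟨(B.submoduleOf A).mkQ x, rfl⟩
  · intro x
    obtain ⟨x, rfl⟩ := Submodule.mkQ_surjective _ x
    rw [Submodule.mkQ_apply, Submodule.mapQ_apply, Submodule.Quotient.mk_eq_zero]
    constructor
    · intro hx
      exact ⟨(B.submoduleOf C).mkQ ⟨x, hx⟩, rfl⟩
    · rintro ⟨y, hy⟩
      obtain ⟨y, rfl⟩ := Submodule.mkQ_surjective _ y
      rw [Submodule.mkQ_apply, Submodule.mapQ_apply, Submodule.Quotient.eq] at hy
      have h3 : (y : E) - x ∈ C := h1 hy
      have : (x : E) = y - (y - x) := by abel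
      change (x : E) ∈ C
      rw [this]
      exact C.sub_mem y.2 h3

theorem relLen_sup (A B : Submodule R E) : relLen B (A ⊔ B) = relLen (A ⊓ B) A := by
  symm
  apply relLen_transfer LinearMap.id
  · intro x hx; exact le_sup_left (a := A) hx
  · intro y hy
    obtain ⟨a, ha, b, hb, rfl⟩ := Submodule.mem_sup.mp hy
    exact ⟨a, ha, by simpa using hb⟩
  · intro x hx
    simp [hx]

theorem relLen_self {A B : Submodule R E} (h : A ≤ B) : relLen B A = 0 := by
  rw [relLen, Module.length_eq_zero_iff, Submodule.Quotient.subsingleton_iff]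
  exact Submodule.submoduleOf_eq_top.mpr h

theorem relLen_toNat_add {A B C : Submodule R E} (h1 : B ≤ C) (h2 : C ≤ A)
    (hf : relLen B A ≠ ⊤) :
    ((relLen B A).toNat : ℚ) = (relLen B C).toNat + (relLen C A).toNat := by
  rw [relLen_add h1 h2] at hf ⊢
  rw [ENat.toNat_add (fun h => hf (by simp [h])) (fun h => hf (by simp [h]))]
  push_cast
  rfl

end relLen

/-! ### Families of submodules -/

section families
variable {R E : Type*} [CommRing R] [AddCommGroup E] [Module R E] {r : ℕ}

/-- The family `C` is stable under the operators `(i, a) ∈ s`, acting as multiplication by `a`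
in degree `e_i`. -/
def FStable (s : Finset (Fin r × R)) (C : (Fin r → ℕ) → Submodule R E) : Prop :=
  ∀ p ∈ s, ∀ m, ∀ x ∈ C m, p.2 • x ∈ C (m + Pi.single p.1 1)

/-- Ascending chain condition for stable families between `B` and `A`. -/
def FACC (s : Finset (Fin r × R)) (B A : (Fin r → ℕ) → Submodule R E) : Prop :=
  ∀ C : ℕ → (Fin r → ℕ) → Submodule R E, (∀ j, FStable s (C j)) → (∀ j, B ≤ C j) →
    (∀ j, C j ≤ A) → Monotone C → ∃ j₀, ∀ j, j₀ ≤ j → C j = C j₀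

theorem FACC.mono {s : Finset (Fin r × R)} {B A B' A' : (Fin r → ℕ) → Submodule R E}
    (h : FACC s B A) (hB : B ≤ B') (hA : A' ≤ A) : FACC s B' A' :=
  fun C h1 h2 h3 h4 => h C h1 (fun j => hB.trans (h2 j)) (fun j => (h3 j).trans hA) h4

theorem FACC.shift {s : Finset (Fin r × R)} {B A : (Fin r → ℕ) → Submodule R E}
    (h : FACC s B A) (hB : FStable s B) (hBA : B ≤ A) (i : Fin r) :
    FACC s (fun m => B (m + Pi.single i 1)) (fun m => A (m + Pi.single i 1)) := by
  intro C h1 h2 h3 h4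
  let D : ℕ → (Fin r → ℕ) → Submodule R E := fun j m =>
    if 1 ≤ m i then C j (m - Pi.single i 1) else B m
  have hD : ∀ j m, D j (m + Pi.single i 1) = C j m := by
    intro j m
    simp [D]
  have hD0 : ∀ j m, ¬ 1 ≤ m i → D j m = B m := by
    intro j m hm
    simp [D, hm]
  have hex : ∀ m : Fin r → ℕ, 1 ≤ m i → ∃ m' : Fin r → ℕ, m = m' + Pi.single i 1 := by
    intro m hm
    refine ⟨m - Pi.single i 1, ?_⟩
    ext k
    by_cases hk : k = i
    · subst hk; simp; omega
    · simp [hk]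
  have hBD : ∀ j, B ≤ D j := by
    intro j m
    by_cases hm : 1 ≤ m i
    · obtain ⟨m, rfl⟩ := hex m hm
      rw [hD]; exact h2 j m
    · rw [hD0 _ _ hm]
  suffices hh : ∃ k, ∀ j, k ≤ j → D j = D k by
    obtain ⟨j₀, hj⟩ := hh
    refine ⟨j₀, fun j hjj => ?_⟩
    funext m
    rw [← hD, hj j hjj, hD]
  refine h D ?_ hBD ?_ ?_
  · intro j p hp m x hx
    by_cases hm : 1 ≤ m i
    · obtain ⟨m, rfl⟩ := hex m hm
      rw [hD] at hx
      rw [add_right_comm, hD]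
      exact h1 j p hp m x hx
    · rw [hD0 _ _ hm] at hx
      exact hBD j _ (hB p hp m x hx)
  · intro j m
    by_cases hm : 1 ≤ m i
    · obtain ⟨m, rfl⟩ := hex m hm
      rw [hD]; exact h3 j m
    · rw [hD0 _ _ hm]; exact hBA m
  · intro j k hjk m
    by_cases hm : 1 ≤ m i
    · obtain ⟨m, rfl⟩ := hex m hm
      rw [hD, hD]; exact h4 hjk m
    · rw [hD0 _ _ hm, hD0 _ _ hm]

theorem hilbert_zero {s : Finset (Fin r × R)} {B A : (Fin r → ℕ) → Submodule R E}
    (hA : FStable s A) (hB : FStable s B) (hBA : B ≤ A) (h : FACC s B A) (i : Fin r)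
    (hi : ∀ p ∈ s, p.1 ≠ i) : ∃ k, ∀ m : Fin r → ℕ, k < m i → A m = B m := by
  let C : ℕ → (Fin r → ℕ) → Submodule R E := fun j m => if m i ≤ j then A m else B m
  suffices hh : ∃ k, ∀ j, k ≤ j → C j = C k by
    obtain ⟨k, hk⟩ := hh
    refine ⟨k, fun m hm => ?_⟩
    have := congrFun (hk (m i) hm.le) m
    simpa [C, not_le.mpr hm] using this
  refine h C ?_ ?_ ?_ ?_
  · intro j p hp m x hx
    have : (m + Pi.single p.1 1 : Fin r → ℕ) i = m i := by
      simp [Pi.single_eq_of_ne (hi p hp).symm]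
    simp only [C, this] at hx ⊢
    split_ifs at hx ⊢ with hm
    · exact hA p hp m x hx
    · exact hB p hp m x hx
  · intro j m
    simp only [C]
    split_ifs
    · exact hBA m
    · exact le_rfl
  · intro j m
    simp only [C]
    split_ifs
    · exact le_rfl
    · exact hBA m
  · intro j k hjk m
    simp only [C]
    split_ifs
    · exact le_rfl
    · omega
    · exact hBA m
    · exact le_rfl

open Classical in
theorem hilbert (n : ℕ) : ∀ (s : Finset (Fin r × R)), s.card = n →
    ∀ (B A : (Fin r → ℕ) → Submodule R E),
    FStable s A → FStable s B → B ≤ A → FACC s B A →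
    (∃ c₀ : Fin r → ℕ, ∀ m, c₀ ≤ m → relLen (B m) (A m) ≠ ⊤) →
    EvPoly (fun m => ((relLen (B m) (A m)).toNat : ℚ)) := by
  induction n with
  | zero =>
    intro s hs B A hA hB hBA hacc hfin
    apply evPoly_of_diff
    intro i
    obtain ⟨k, hk⟩ := hilbert_zero hA hB hBA hacc i (by
      intro p hp; rw [Finset.card_eq_zero.mp hs] at hp; simp at hp)
    refine ⟨Pi.single i (k + 1), 0, fun m hm => ?_⟩
    have h1 : k + 1 ≤ m i := by
      have := hm i
      rwa [Pi.single_eq_same] at this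
    simp only
    rw [hk m (by omega), hk _ (by simp; omega), relLen_self le_rfl, relLen_self le_rfl]
    simp
  | succ n ih =>
    intro s hs B A hA hB hBA hacc hfin
    apply evPoly_of_diff
    intro i
    by_cases hi : ∀ p ∈ s, p.1 ≠ i
    · obtain ⟨k, hk⟩ := hilbert_zero hA hB hBA hacc i hi
      refine ⟨Pi.single i (k + 1), 0, fun m hm => ?_⟩
      have h1 : k + 1 ≤ m i := by
        have := hm i
        rwa [Pi.single_eq_same] at this
      simp only
      rw [hk m (by omega), hk _ (by simp; omega), relLen_self le_rfl, relLen_self le_rfl]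
      simp
    push Not at hi
    obtain ⟨p, hp, rfl⟩ := hi
    obtain ⟨c₀, hc₀⟩ := hfin
    have hcard : (s.erase p).card = n := by rw [Finset.card_erase_of_mem hp, hs]; rfl
    have hsub : ∀ q ∈ s.erase p, q ∈ s := fun q hq => Finset.mem_of_mem_erase hq
    -- kernel
    let K : (Fin r → ℕ) → Submodule R E := fun m =>
      A m ⊓ (B (m + Pi.single p.1 1)).comap (LinearMap.lsmul R E p.2)
    have memK : ∀ m x, x ∈ K m ↔ x ∈ A m ∧ p.2 • x ∈ B (m + Pi.single p.1 1) := by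
      intro m x; rfl
    -- image
    let Q : (Fin r → ℕ) → Submodule R E := fun m =>
      B (m + Pi.single p.1 1) ⊔ (A m).map (LinearMap.lsmul R E p.2)
    let A' : (Fin r → ℕ) → Submodule R E := fun m => A (m + Pi.single p.1 1)
    have hKA : K ≤ A := fun m => inf_le_left
    have hBK : B ≤ K := fun m x hx => (memK m x).mpr ⟨hBA m hx, hB p hp m x hx⟩
    have hBQ : ∀ m, B (m + Pi.single p.1 1) ≤ Q m := fun m => le_sup_left
    have hQA : Q ≤ A' := by
      intro m
      refine sup_le (hBA _) ?_
      rintro _ ⟨x, hx, rfl⟩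
      exact hA p hp m x hx
    have hKs : FStable s K := by
      intro q hq m x hx
      rw [memK] at hx ⊢
      refine ⟨hA q hq m x hx.1, ?_⟩
      rw [smul_comm, add_right_comm]
      exact hB q hq _ _ hx.2
    have hA's : FStable s A' := by
      intro q hq m x hx
      have := hA q hq _ x hx
      rw [add_right_comm] at this
      exact this
    have hQs : FStable s Q := by
      intro q hq m x hx
      obtain ⟨b, hb, y, ⟨a, ha, rfl⟩, rfl⟩ := Submodule.mem_sup.mp hx
      rw [smul_add]
      refine Submodule.add_mem _ (Submodule.mem_sup_left ?_) (Submodule.mem_sup_right ?_)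
      · have := hB q hq _ b hb
        rw [add_right_comm] at this
        exact this
      · exact ⟨q.2 • a, hA q hq m a ha, by simp⟩
    have hKacc : FACC (s.erase p) B K := by
      intro C h1 h2 h3 h4
      refine hacc C ?_ h2 (fun j => (h3 j).trans hKA) h4
      intro j q hq m x hx
      by_cases hqp : q = p
      · subst hqp
        exact h2 j _ ((memK m x).mp (h3 j m hx)).2
      · exact h1 j q (Finset.mem_erase.mpr ⟨hqp, hq⟩) m x hx
    have hQacc : FACC (s.erase p) Q A' := by
      intro C h1 h2 h3 h4
      refine hacc.shift hB hBA p.1 C ?_ (fun j => le_trans hBQ (h2 j)) h3 h4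
      intro j q hq m x hx
      by_cases hqp : q = p
      · subst hqp
        exact h2 j _ (Submodule.mem_sup_right ⟨x, h3 j m hx, rfl⟩)
      · exact h1 j q (Finset.mem_erase.mpr ⟨hqp, hq⟩) m x hx
    have hc₀' : ∀ m, c₀ ≤ m → c₀ ≤ m + Pi.single p.1 1 := fun m hm =>
      hm.trans (le_add_of_nonneg_right (Pi.single_nonneg.mpr zero_le_one))
    have kp := ih _ hcard B K (fun q hq => hKs q (hsub q hq)) (fun q hq => hB q (hsub q hq))
      hBK hKacc ⟨c₀, fun m hm h => hc₀ m hm (by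
        rw [relLen_add (hBK m) (hKA m), h, top_add])⟩
    have qp := ih _ hcard Q A' (fun q hq => hA's q (hsub q hq)) (fun q hq => hQs q (hsub q hq))
      hQA hQacc ⟨c₀, fun m hm h => hc₀ _ (hc₀' m hm) (by
        rw [relLen_add (hBQ m) (hQA m), h, add_top])⟩
    refine (qp.sub kp).congr c₀ fun m hm => ?_
    have e1 := relLen_toNat_add (hBK m) (hKA m) (hc₀ m hm)
    have e2 := relLen_toNat_add (hBQ m) (hQA m) (hc₀ _ (hc₀' m hm))
    have e3 : relLen (K m) (A m) = relLen (B (m + Pi.single p.1 1)) (Q m) := by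
      apply relLen_transfer (LinearMap.lsmul R E p.2)
      · intro x hx
        exact Submodule.mem_sup_right ⟨x, hx, rfl⟩
      · intro y hy
        obtain ⟨b, hb, y, ⟨a, ha, rfl⟩, rfl⟩ := Submodule.mem_sup.mp hy
        exact ⟨a, ha, by simpa using hb⟩
      · intro x hx
        rw [memK]
        exact ⟨fun h => ⟨hx, h⟩, fun h => h.2⟩
    rw [e3] at e1
    linarith

end families

/-! ### The ascending chain condition from the Rees algebra -/

section rees
variable {R E : Type*} [CommRing R] [AddCommGroup E] [Module R E] {r : ℕ}

theorem rees_smul {g : ℕ} (v : Fin g → E) (s : Finset (Fin r × R))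
    (C : (Fin r → ℕ) → Submodule R E) (hC : FStable s C) (q : MvPolynomial (Fin r) R)
    (hq : q ∈ Algebra.adjoin R
      ((fun p : Fin r × R => MvPolynomial.C p.2 * MvPolynomial.X p.1) '' (s : Set (Fin r × R)))) :
    ∀ p : Fin g → MvPolynomial (Fin r) R,
      (∀ u : Fin r →₀ ℕ, ∑ j, (p j).coeff u • v j ∈ C u) →
      (∀ u : Fin r →₀ ℕ, ∑ j, (q * p j).coeff u • v j ∈ C u) := by
  induction hq using Algebra.adjoin_induction with
  | mem q hq =>
    obtain ⟨⟨i, a⟩, hia, rfl⟩ := hq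
    intro p hp u
    simp only [mul_assoc, MvPolynomial.coeff_C_mul, MvPolynomial.coeff_X_mul']
    split_ifs with hu
    · have h1 := hC _ hia _ _ (hp (u - Finsupp.single i 1))
      have h2 : (⇑(u - Finsupp.single i 1 : Fin r →₀ ℕ) : Fin r → ℕ) + Pi.single i 1 = ⇑u := by
        ext k
        by_cases hk : k = i
        · subst hk
          have : u k ≠ 0 := by simpa using hu
          simp; omega
        · simp [hk]
      rw [h2, Finset.smul_sum] at h1
      simpa only [mul_smul] using h1
    · simp
  | algebraMap a =>
    intro p hp u
    simp only [MvPolynomial.algebraMap_eq, MvPolynomial.coeff_C_mul, mul_smul]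
    rw [← Finset.smul_sum]
    exact Submodule.smul_mem _ _ (hp u)
  | add x y _ _ hx hy =>
    intro p hp u
    simp only [add_mul, MvPolynomial.coeff_add, add_smul, Finset.sum_add_distrib]
    exact Submodule.add_mem _ (hx p hp u) (hy p hp u)
  | mul x y _ _ hx hy =>
    intro p hp u
    simp only [mul_assoc]
    exact hx _ (hy p hp) u

theorem monomial_mem_rees (I : Fin r → Ideal R) (s : Finset (Fin r × R))
    (hs : ∀ i, I i = Ideal.span {a | (i, a) ∈ s}) (u : Fin r →₀ ℕ) (a : R)
    (ha : a ∈ prodPow I u) :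
    MvPolynomial.monomial u a ∈ Algebra.adjoin R
      ((fun p : Fin r × R => MvPolynomial.C p.2 * MvPolynomial.X p.1) ''
        (s : Set (Fin r × R))) := by
  set S := Algebra.adjoin R
      ((fun p : Fin r × R => MvPolynomial.C p.2 * MvPolynomial.X p.1 :
        Fin r × R → MvPolynomial (Fin r) R) '' (s : Set (Fin r × R)))
  let J : (Fin r →₀ ℕ) → Ideal R := fun u =>
    (Subalgebra.toSubmodule S).comap (MvPolynomial.monomial u)
  have memJ : ∀ u a, a ∈ J u ↔ MvPolynomial.monomial u a ∈ S := fun u a => Iff.rfl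
  have hmul : ∀ u w, J u * J w ≤ J (u + w) := by
    intro u w
    rw [Ideal.mul_le]
    intro a ha b hb
    rw [memJ] at *
    rw [← MvPolynomial.monomial_mul]
    exact mul_mem ha hb
  have hone : (1 : Ideal R) ≤ J 0 := by
    intro a _
    rw [memJ]
    exact S.algebraMap_mem a
  have hI : ∀ i, I i ≤ J (Finsupp.single i 1) := by
    intro i
    rw [hs i, Ideal.span_le]
    intro a ha
    change a ∈ J (Finsupp.single i 1)
    rw [memJ, ← MvPolynomial.C_mul_X_eq_monomial]
    exact Algebra.subset_adjoin ⟨(i, a), ha, rfl⟩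
  have hpow : ∀ i k, I i ^ k ≤ J (Finsupp.single i k) := by
    intro i k
    induction k with
    | zero => simpa using hone
    | succ k ih =>
      rw [pow_succ, Finsupp.single_add]
      exact (Ideal.mul_mono ih (hI i)).trans (hmul _ _)
  have hprod : ∀ t : Finset (Fin r), ∏ i ∈ t, I i ^ u i ≤ J (∑ i ∈ t, Finsupp.single i (u i)) := by
    intro t
    induction t using Finset.induction_on with
    | empty => simpa using hone
    | insert i t hi ih =>
      rw [Finset.prod_insert hi, Finset.sum_insert hi]
      exact (Ideal.mul_mono (hpow _ _) ih).trans (hmul _ _)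
  have := hprod Finset.univ ha
  rwa [Finsupp.univ_sum_single, memJ] at this

theorem facc_base [IsNoetherianRing R] (I : Fin r → Ideal R) (s : Finset (Fin r × R))
    (hs : ∀ i, I i = Ideal.span {a | (i, a) ∈ s}) (V : Submodule R E) (hV : V.FG) :
    FACC s ⊥ (fun m => prodPow I m • V) := by
  classical
  obtain ⟨g, v, rfl⟩ := Submodule.fg_iff_exists_fin_generating_family.mp hV
  intro C h1 h2 h3 h4
  let S := Algebra.adjoin R
      ((fun p : Fin r × R => MvPolynomial.C p.2 * MvPolynomial.X p.1 :
        Fin r × R → MvPolynomial (Fin r) R) '' (s : Set (Fin r × R)))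
  have hS : IsNoetherianRing S := by
    apply isNoetherianRing_of_fg
    exact Subalgebra.fg_def.2 ⟨_, s.finite_toSet.image _, rfl⟩
  have hN : IsNoetherian S (Fin g → S) := inferInstance
  let H : ℕ → Submodule S (Fin g → S) := fun j =>
    { carrier := {p | ∀ u : Fin r →₀ ℕ,
        ∑ k, (p k : MvPolynomial (Fin r) R).coeff u • v k ∈ C j u}
      add_mem' := by
        intro p q hp hq u
        have := Submodule.add_mem _ (hp u) (hq u)
        rw [← Finset.sum_add_distrib] at this
        simpa [add_smul] using this
      zero_mem' := by
        intro u
        simp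
      smul_mem' := by
        intro q p hp
        exact rees_smul v s (C j) (h1 j) q q.2 (fun k => (p k : MvPolynomial (Fin r) R)) hp }
  have memH : ∀ j (p : Fin g → S), p ∈ H j ↔ ∀ u : Fin r →₀ ℕ,
        ∑ k, (p k : MvPolynomial (Fin r) R).coeff u • v k ∈ C j u := fun j p => Iff.rfl
  have hmono : Monotone H := by
    intro j k hjk p hp u
    exact h4 hjk u (hp u)
  obtain ⟨j₀, hj₀⟩ := monotone_stabilizes_iff_noetherian.mpr hN ⟨H, hmono⟩
  refine ⟨j₀, fun j hj => le_antisymm ?_ (h4 hj)⟩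
  intro m x hx
  obtain ⟨a, ha, hax⟩ := (Submodule.mem_ideal_smul_span_iff_exists_sum _ v x).mp (h3 j m hx)
  let u : Fin r →₀ ℕ := Finsupp.equivFunOnFinite.symm m
  have hu : (u : Fin r → ℕ) = m := by ext; simp [u]
  have hax' : ∑ k, a k • v k = x := by
    rw [← hax, Finsupp.sum_fintype]
    simp
  let p : Fin g → S := fun k => ⟨MvPolynomial.monomial u (a k),
    monomial_mem_rees I s hs u (a k) (by rw [hu]; exact ha k)⟩
  have hp : p ∈ H j := by
    rw [memH]
    intro w
    simp only [p, MvPolynomial.coeff_monomial]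
    by_cases hw : u = w
    · subst hw
      simp only [if_true]
      rw [hax', hu]
      exact hx
    · simp [hw]
  have e : H j₀ = H j := hj₀ j hj
  rw [← e, memH] at hp
  have := hp u
  simp only [p, MvPolynomial.coeff_monomial, if_true] at this
  rwa [hax', hu] at this

end rees

/-! ### Compatible families, Artin-Rees and the core theorem -/

section core
variable {R E : Type*} [CommRing R] [AddCommGroup E] [Module R E] {r : ℕ}

theorem prodPow_add (I : Fin r → Ideal R) (m n : Fin r → ℕ) :
    prodPow I (m + n) = prodPow I m * prodPow I n := by
  simp [prodPow, pow_add, Finset.prod_mul_distrib]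

theorem prodPow_zero (I : Fin r → Ideal R) : prodPow I 0 = ⊤ := by
  simp [prodPow]

theorem prodPow_single (I : Fin r → Ideal R) (i : Fin r) :
    prodPow I (Pi.single i 1) = I i := by
  rw [prodPow, Finset.prod_eq_single i]
  · simp
  · intro j _ hj
    simp [hj]
  · simp

theorem exists_gens [IsNoetherianRing R] (I : Fin r → Ideal R) :
    ∃ s : Finset (Fin r × R), ∀ i, I i = Ideal.span {a | (i, a) ∈ s} := by
  classical
  have : ∀ i, ∃ t : Finset R, Ideal.span (t : Set R) = I i := fun i =>
    (isNoetherianRing_iff_ideal_fg R).mp inferInstance (I i)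
  choose t ht using this
  refine ⟨Finset.univ.biUnion fun i => (t i).image fun a => (i, a), fun i => ?_⟩
  rw [← ht i]
  congr 1
  ext a
  simp

/-- Compatibility of a family of submodules with the ideals `I`. -/
def Compat (I : Fin r → Ideal R) (C : (Fin r → ℕ) → Submodule R E) : Prop :=
  ∀ k l, prodPow I k • C l ≤ C (l + k)

theorem Compat.stable {I : Fin r → Ideal R} {C : (Fin r → ℕ) → Submodule R E}
    (hC : Compat I C) {s : Finset (Fin r × R)}
    (hs : ∀ i, I i = Ideal.span {a | (i, a) ∈ s}) : FStable s C := by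
  rintro ⟨i, a⟩ hp m x hx
  refine hC (Pi.single i 1) m (Submodule.smul_mem_smul ?_ hx)
  rw [prodPow_single, hs i]
  exact Ideal.subset_span hp

theorem compat_pow (I : Fin r → Ideal R) (V : Submodule R E) :
    Compat I (fun m => prodPow I m • V) := by
  intro k l
  simp only
  rw [add_comm l k, prodPow_add, mul_smul]

theorem compat_const (I : Fin r → Ideal R) (U : Submodule R E) :
    Compat I (fun _ => U) := fun _ _ => Submodule.smul_le_right

theorem Compat.inf {I : Fin r → Ideal R} {C D : (Fin r → ℕ) → Submodule R E}
    (hC : Compat I C) (hD : Compat I D) : Compat I (fun m => C m ⊓ D m) := fun k l =>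
  le_inf ((Submodule.smul_mono le_rfl inf_le_left).trans (hC k l))
    ((Submodule.smul_mono le_rfl inf_le_right).trans (hD k l))

theorem Compat.sup {I : Fin r → Ideal R} {C D : (Fin r → ℕ) → Submodule R E}
    (hC : Compat I C) (hD : Compat I D) : Compat I (fun m => C m ⊔ D m) := by
  intro k l
  simp only
  rw [Submodule.smul_sup]
  exact sup_le_sup (hC k l) (hD k l)

theorem Compat.shift {I : Fin r → Ideal R} {C : (Fin r → ℕ) → Submodule R E}
    (hC : Compat I C) (d : Fin r → ℕ) : Compat I (fun m => C (m + d)) := by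
  intro k l
  simp only
  rw [add_right_comm]
  exact hC k _

theorem artinRees [IsNoetherianRing R] (I : Fin r → Ideal R) (V : Submodule R E) (hV : V.FG)
    (C : (Fin r → ℕ) → Submodule R E) (hC : Compat I C) (hCV : ∀ m, C m ≤ prodPow I m • V) :
    ∃ c₀ : ℕ, ∀ c : Fin r → ℕ, (∀ i, c₀ ≤ c i) → ∀ m, C (c + m) = prodPow I m • C c := by
  obtain ⟨s, hs⟩ := exists_gens I
  have hacc := facc_base I s hs V hV
  let D : ℕ → (Fin r → ℕ) → Submodule R E := fun j m =>
    ⨆ (l : Fin r → ℕ) (k : Fin r → ℕ) (_ : l + k = m) (_ : ∀ i, l i ≤ j), prodPow I k • C l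
  have leD : ∀ j l k, (∀ i, l i ≤ j) → prodPow I k • C l ≤ D j (l + k) := by
    intro j l k hl
    exact le_iSup_of_le l (le_iSup_of_le k (le_iSup_of_le rfl (le_iSup_of_le hl le_rfl)))
  have Dle : ∀ j m X, (∀ l k, l + k = m → (∀ i, l i ≤ j) → prodPow I k • C l ≤ X) →
      D j m ≤ X := fun j m X h =>
    iSup_le fun l => iSup_le fun k => iSup_le fun h1 => iSup_le fun h2 => h l k h1 h2
  have hDC : ∀ j, D j ≤ C := by
    intro j m
    apply Dle
    rintro l k rfl -
    exact hC k l
  obtain ⟨j₀, hj₀⟩ := hacc D (by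
    intro j
    apply Compat.stable (I := I) _ hs
    intro k m
    rw [Submodule.smul_le]
    intro a ha x hx
    have : D j m ≤ (D j (m + k)).comap (LinearMap.lsmul R E a) := by
      apply Dle
      rintro l k' rfl hl x hx
      have h1 := leD j l (k + k') hl
      rw [show l + k' + k = l + (k + k') by abel]
      apply h1
      rw [prodPow_add, mul_smul]
      exact Submodule.smul_mem_smul ha hx
    exact this hx) (fun j => bot_le) (fun j => (hDC j).trans hCV) (by
    intro j k hjk m
    apply Dle
    rintro l k' rfl hl
    exact leD k l k' fun i => (hl i).trans hjk)
  refine ⟨j₀, fun c hc m => le_antisymm ?_ ?_⟩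
  · have h1 : C (c + m) ≤ D (j₀ + ∑ i, (c + m) i) (c + m) := by
      have := leD (j₀ + ∑ i, (c + m) i) (c + m) 0 (fun i => by
        have := Finset.single_le_sum (f := fun i => (c + m) i) (fun i _ => Nat.zero_le _)
          (Finset.mem_univ i)
        omega)
      rwa [prodPow_zero, Submodule.top_smul, add_zero] at this
    rw [hj₀ _ (by simp)] at h1
    refine h1.trans (Dle _ _ _ ?_)
    intro l k hlk hl
    obtain ⟨d, hd⟩ := exists_add_of_le (show l ≤ c from fun i => (hl i).trans (hc i))
    have hk : k = m + d := by
      rw [hd, add_assoc] at hlk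
      rw [add_left_cancel hlk, add_comm]
    rw [hk, prodPow_add, mul_smul]
    refine Submodule.smul_mono le_rfl ?_
    rw [hd]
    exact hC d l
  · exact hC m c

theorem hilbert_compat [IsNoetherianRing R] (I : Fin r → Ideal R) (V : Submodule R E)
    (hV : V.FG) (B A : (Fin r → ℕ) → Submodule R E) (hB : Compat I B) (hA : Compat I A)
    (hBA : B ≤ A) (hAV : ∀ m, A m ≤ prodPow I m • V)
    (hfin : ∃ c₀ : Fin r → ℕ, ∀ m, c₀ ≤ m → relLen (B m) (A m) ≠ ⊤) :
    EvPoly (fun m => ((relLen (B m) (A m)).toNat : ℚ)) := by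
  obtain ⟨s, hs⟩ := exists_gens I
  exact hilbert _ s rfl B A (hA.stable hs) (hB.stable hs) hBA
    ((facc_base I s hs V hV).mono bot_le hAV) hfin

theorem core_thm [IsNoetherianRing R] [Module.Finite R E] (I : Fin r → Ideal R)
    (U' U V' V : Submodule R E) (hU : U' ≤ U) (hV : V' ≤ V)
    (hfin : ∃ c₀ : Fin r → ℕ, ∀ m, c₀ ≤ m →
      relLen (U' ⊔ prodPow I m • V') (U ⊔ prodPow I m • V) ≠ ⊤) :
    EvPoly (fun m => ((relLen (U' ⊔ prodPow I m • V') (U ⊔ prodPow I m • V)).toNat : ℚ)) := by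
  have hfg : ∀ W : Submodule R E, W.FG := fun W => IsNoetherian.noetherian W
  obtain ⟨c₀, hc₀⟩ := hfin
  have le1 : ∀ m, U' ⊔ prodPow I m • V' ≤ U ⊔ prodPow I m • V' :=
    fun m => sup_le_sup_right hU _
  have le2 : ∀ m, U ⊔ prodPow I m • V' ≤ U ⊔ prodPow I m • V :=
    fun m => sup_le_sup_left (Submodule.smul_mono le_rfl hV) _
  -- second part
  have e2 : ∀ m, relLen (U ⊔ prodPow I m • V') (U ⊔ prodPow I m • V) =
      relLen ((prodPow I m • V) ⊓ (U ⊔ prodPow I m • V')) (prodPow I m • V) := by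
    intro m
    rw [← relLen_sup]
    congr 1
    apply le_antisymm
    · exact sup_le (le_sup_left.trans le_sup_right) le_sup_left
    · exact sup_le le_sup_right (le2 m)
  have p2 : EvPoly (fun m =>
      ((relLen (U ⊔ prodPow I m • V') (U ⊔ prodPow I m • V)).toNat : ℚ)) := by
    simp only [e2]
    refine hilbert_compat I V (hfg V)
      (fun m => (prodPow I m • V) ⊓ (U ⊔ prodPow I m • V')) (fun m => prodPow I m • V)
      ((compat_pow I V).inf ((compat_const I U).sup (compat_pow I V'))) (compat_pow I V)
      (fun m => inf_le_left) (fun m => le_rfl) ⟨c₀, fun m hm h => hc₀ m hm ?_⟩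
    rw [← e2] at h
    rw [relLen_add (le1 m) (le2 m), h, add_top]
  -- first part
  let C : (Fin r → ℕ) → Submodule R E := fun m => U ⊓ (U' ⊔ prodPow I m • V')
  let D : (Fin r → ℕ) → Submodule R E := fun m => U ⊓ prodPow I m • V'
  have hC : Compat I C := (compat_const I U).inf ((compat_const I U').sup (compat_pow I V'))
  have hD : Compat I D := (compat_const I U).inf (compat_pow I V')
  have e1 : ∀ m, relLen (U' ⊔ prodPow I m • V') (U ⊔ prodPow I m • V') = relLen (C m) U := by
    intro m
    rw [← relLen_sup]
    congr 1
    rw [← sup_assoc, sup_eq_left.mpr hU]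
  have f1 : ∀ m, c₀ ≤ m → relLen (C m) U ≠ ⊤ := by
    intro m hm h
    refine hc₀ m hm ?_
    rw [relLen_add (le1 m) (le2 m), e1, h, top_add]
  have p1 : EvPoly (fun m => ((relLen (C m) U).toNat : ℚ)) := by
    apply evPoly_of_diff
    intro i
    have hle : ∀ m, C (m + Pi.single i 1) ≤ C m := by
      intro m
      refine inf_le_inf_left _ (sup_le_sup_left ?_ _)
      rw [add_comm, prodPow_add, mul_smul]
      exact Submodule.smul_le_right
    have hc₀' : ∀ m, c₀ ≤ m → c₀ ≤ m + Pi.single i 1 := fun m hm =>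
      hm.trans (le_add_of_nonneg_right (Pi.single_nonneg.mpr zero_le_one))
    have e3 : ∀ m, relLen (C (m + Pi.single i 1)) (C m) =
        relLen (D m ⊓ C (m + Pi.single i 1)) (D m) := by
      intro m
      rw [← relLen_sup]
      congr 1
      apply le_antisymm
      · have : C m ≤ U' ⊔ D m := by
          simp only [C, D]
          rw [inf_comm, sup_inf_assoc_of_le _ hU, inf_comm]
        refine this.trans (sup_le (le_trans ?_ le_sup_right) le_sup_left)
        exact le_inf hU le_sup_left
      · exact sup_le (inf_le_inf_left _ le_sup_right) (hle m)
    have add3 : ∀ m, relLen (C (m + Pi.single i 1)) U =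
        relLen (C (m + Pi.single i 1)) (C m) + relLen (C m) U :=
      fun m => relLen_add (hle m) inf_le_left
    have hB : Compat I (fun m => D m ⊓ C (m + Pi.single i 1)) :=
      hD.inf (hC.shift (Pi.single i 1))
    have hB1 : (fun m => D m ⊓ C (m + Pi.single i 1)) ≤ D := fun m => inf_le_left
    have hD1 : ∀ m, D m ≤ prodPow I m • V' := fun m => inf_le_right
    have q := hilbert_compat I V' (hfg V') (fun m => D m ⊓ C (m + Pi.single i 1)) D
      hB hD hB1 hD1
      ⟨c₀, fun m hm h => f1 _ (hc₀' m hm) (by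
        rw [add3, e3, h, top_add])⟩
    refine q.congr c₀ fun m hm => ?_
    rw [relLen_toNat_add (hle m) inf_le_left (f1 _ (hc₀' m hm)), e3]
    ring
  refine (p1.add p2).congr c₀ fun m hm => ?_
  rw [relLen_toNat_add (le1 m) (le2 m) (hc₀ m hm), e1]

end core

/-! ### Reduction of the coherent functor to families of submodules -/

section reduction
variable {R : Type*} [CommRing R] {r : ℕ}

theorem relLen_sup_eq {E : Type*} [AddCommGroup E] [Module R E] (A B : Submodule R E) :
    relLen B (A ⊔ B) = relLen B A := by
  rw [relLen_sup]
  apply relLen_transfer LinearMap.id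
  · intro x hx; exact hx
  · intro y hy; exact ⟨y, hy, by simp⟩
  · intro x hx; simp [hx]

theorem pi_smul {M : Type*} [AddCommGroup M] [Module R M] (J : Ideal R) (N : Submodule R M)
    (p : ℕ) : Submodule.pi Set.univ (fun _ : Fin p => J • N) =
      J • Submodule.pi Set.univ (fun _ : Fin p => N) := by
  apply le_antisymm
  · intro x hx
    rw [← Finset.univ_sum_single x]
    refine Submodule.sum_mem _ fun i _ => ?_
    have h1 : x i ∈ J • N := hx i (Set.mem_univ i)
    have h2 : J • N ≤ (J • Submodule.pi Set.univ (fun _ : Fin p => N)).comap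
        (LinearMap.single R (fun _ : Fin p => M) i) := by
      rw [← Submodule.map_le_iff_le_comap, Submodule.map_smul'']
      refine Submodule.smul_mono le_rfl ?_
      rw [Submodule.map_le_iff_le_comap]
      intro y hy j _
      by_cases hj : j = i
      · subst hj; simpa using hy
      · simp [hj]
    exact h2 h1
  · rw [Submodule.smul_le]
    intro a ha x hx i hi
    exact Submodule.smul_mem_smul ha (hx i hi)

theorem comap_pow [IsNoetherianRing R] {E E' : Type*} [AddCommGroup E] [Module R E]
    [AddCommGroup E'] [Module R E'] (I : Fin r → Ideal R) (φ : E →ₗ[R] E')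
    (P : Submodule R E') (hP : P.FG) :
    ∃ c₀ : ℕ, ∀ c : Fin r → ℕ, (∀ i, c₀ ≤ c i) → ∀ m,
      (prodPow I (c + m) • P).comap φ =
        LinearMap.ker φ ⊔ prodPow I m • (prodPow I c • P).comap φ := by
  obtain ⟨c₀, hc₀⟩ := artinRees I P hP (fun m => LinearMap.range φ ⊓ prodPow I m • P)
    ((compat_const I _).inf (compat_pow I P)) (fun m => inf_le_right)
  refine ⟨c₀, fun c hc m => ?_⟩
  have h := hc₀ c hc m
  rw [← Submodule.map_comap_eq, ← Submodule.map_comap_eq, ← Submodule.map_smul''] at h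
  have h2 := congrArg (Submodule.comap φ) h
  rw [Submodule.comap_map_eq, Submodule.comap_map_eq, sup_comm _ (LinearMap.ker φ),
    sup_comm _ (LinearMap.ker φ), sup_eq_right.mpr] at h2
  · exact h2
  · intro x hx
    rw [LinearMap.mem_ker] at hx
    rw [Submodule.mem_comap, hx]
    exact Submodule.zero_mem _

theorem exists_hom {K X : Type*} [AddCommGroup K] [Module R K] [AddCommGroup X] [Module R X]
    {a a' : ℕ} (κ : Fin a → K) (hκ : Submodule.span R (Set.range κ) = ⊤)
    (ρ : Fin a' → Fin a → R)
    (hρ : Submodule.span R (Set.range ρ) = LinearMap.ker (Fintype.linearCombination R κ))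
    (x : Fin a → X) (hx : ∀ k, ∑ i, ρ k i • x i = 0) :
    ∃ g : K →ₗ[R] X, ∀ i, g (κ i) = x i := by
  classical
  have hsurj : Function.Surjective (Fintype.linearCombination R κ) := by
    rw [← LinearMap.range_eq_top, Fintype.range_linearCombination, hκ]
  have hker : LinearMap.ker (Fintype.linearCombination R κ) ≤
      LinearMap.ker (Fintype.linearCombination R x) := by
    rw [← hρ, Submodule.span_le]
    rintro _ ⟨k, rfl⟩
    simpa [Fintype.linearCombination_apply] using hx k
  let e := (Fintype.linearCombination R κ).quotKerEquivOfSurjective hsurj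
  refine ⟨(Submodule.liftQ _ (Fintype.linearCombination R x) hker) ∘ₗ e.symm.toLinearMap, ?_⟩
  intro i
  have : e.symm (κ i) = Submodule.Quotient.mk (Pi.single i 1) := by
    rw [LinearEquiv.symm_apply_eq]
    simp [e, LinearMap.quotKerEquivOfSurjective]
  rw [LinearMap.comp_apply, LinearEquiv.coe_coe, this, Submodule.liftQ_apply]
  simp

theorem relation_hom {K X : Type*} [AddCommGroup K] [Module R K] [AddCommGroup X] [Module R X]
    {a a' : ℕ} (κ : Fin a → K) (ρ : Fin a' → Fin a → R)
    (hρ : Submodule.span R (Set.range ρ) = LinearMap.ker (Fintype.linearCombination R κ))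
    (g : K →ₗ[R] X) (k : Fin a') : ∑ i, ρ k i • g (κ i) = 0 := by
  have : ρ k ∈ LinearMap.ker (Fintype.linearCombination R κ) := by
    rw [← hρ]; exact Submodule.subset_span ⟨k, rfl⟩
  rw [LinearMap.mem_ker, Fintype.linearCombination_apply] at this
  rw [← map_zero g, ← this, map_sum]
  simp

/-- Multiplication by a matrix. -/
def matMap (M : Type*) [AddCommGroup M] [Module R M] {p q : ℕ} (A : Fin p → Fin q → R) :
    (Fin q → M) →ₗ[R] (Fin p → M) :=
  LinearMap.pi fun k => ∑ i, A k i • LinearMap.proj i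

theorem matMap_apply {M : Type*} [AddCommGroup M] [Module R M] {p q : ℕ}
    (A : Fin p → Fin q → R) (x : Fin q → M) (k : Fin p) :
    matMap M A x k = ∑ i, A k i • x i := by
  simp [matMap]

theorem relLen_coherent {M K L : Type*} [AddCommGroup M] [Module R M]
    [AddCommGroup K] [Module R K] [AddCommGroup L] [Module R L] (f : K →ₗ[R] L)
    {a a' b b' : ℕ} (κ : Fin a → K) (hκ : Submodule.span R (Set.range κ) = ⊤)
    (ρ : Fin a' → Fin a → R)
    (hρ : Submodule.span R (Set.range ρ) = LinearMap.ker (Fintype.linearCombination R κ))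
    (l : Fin b → L) (hl : Submodule.span R (Set.range l) = ⊤)
    (σ : Fin b' → Fin b → R)
    (hσ : Submodule.span R (Set.range σ) = LinearMap.ker (Fintype.linearCombination R l))
    (t : Fin a → Fin b → R) (ht : ∀ i, f (κ i) = ∑ j, t i j • l j)
    (A : Submodule R M) :
    relLen (((Submodule.pi Set.univ (fun _ : Fin b' => A)).comap (matMap M σ)).map (matMap M t) ⊔
        Submodule.pi Set.univ (fun _ : Fin a => A))
      ((Submodule.pi Set.univ (fun _ : Fin a' => A)).comap (matMap M ρ)) =
    Module.length R (coherentApply f (M ⧸ A)) := by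
  set Z := (Submodule.pi Set.univ (fun _ : Fin a' => A)).comap (matMap M ρ) with hZ
  have mk_sum : ∀ {q : ℕ} (c : Fin q → R) (x : Fin q → M),
      ∑ i, c i • A.mkQ (x i) = A.mkQ (∑ i, c i • x i) := by
    intro q c x; simp
  have mk0 : ∀ x, A.mkQ x = 0 ↔ x ∈ A := fun x => by simp
  have memc : ∀ {p q : ℕ} (c : Fin p → Fin q → R) (x : Fin q → M),
      x ∈ (Submodule.pi Set.univ (fun _ : Fin p => A)).comap (matMap M c) ↔
      ∀ k, ∑ i, c k i • A.mkQ (x i) = 0 := by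
    intro p q c x
    simp only [Submodule.mem_comap, Submodule.mem_pi, Set.mem_univ, true_imp_iff, matMap_apply,
      mk_sum, mk0]
  have hex : ∀ x : Z, ∃ g : K →ₗ[R] M ⧸ A, ∀ i, g (κ i) = A.mkQ (x.1 i) := fun x =>
    exists_hom κ hκ ρ hρ (fun i => A.mkQ (x.1 i)) ((memc ρ x.1).mp x.2)
  have hext : ∀ g g' : K →ₗ[R] M ⧸ A, (∀ i, g (κ i) = g' (κ i)) → g = g' := by
    intro g g' h
    apply LinearMap.ext_on_range hκ h
  choose g hg using hex
  let G : Z →ₗ[R] (K →ₗ[R] M ⧸ A) :=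
    { toFun := g
      map_add' := by
        intro x y
        apply hext
        intro i
        rw [LinearMap.add_apply, hg, hg, hg, ← map_add]
        rfl
      map_smul' := by
        intro c x
        apply hext
        intro i
        rw [RingHom.id_apply, LinearMap.smul_apply, hg, hg, ← map_smul]
        rfl }
  have hG : ∀ x i, G x (κ i) = A.mkQ (x.1 i) := hg
  refine relLen_eq_length ((LinearMap.range (LinearMap.lcomp R (M ⧸ A) f)).mkQ ∘ₗ G) ?_ ?_
  · refine (Submodule.mkQ_surjective _).comp ?_
    intro h
    choose x hx using fun i => Submodule.mkQ_surjective A (h (κ i))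
    refine ⟨⟨x, (memc ρ x).mpr fun k => ?_⟩, hext _ _ fun i => ?_⟩
    · simp only [hx]
      exact relation_hom κ ρ hρ h k
    · rw [hG]; exact hx i
  · intro x
    rw [LinearMap.comp_apply, Submodule.mkQ_apply, Submodule.Quotient.mk_eq_zero]
    constructor
    · rintro ⟨h, hh⟩
      choose y hy using fun j => Submodule.mkQ_surjective A (h (l j))
      refine Submodule.mem_sup.mpr ⟨matMap M t y, ⟨y, (memc σ y).mpr fun k => ?_, rfl⟩,
        x.1 - matMap M t y, fun i _ => ?_, by abel⟩
      · simp only [hy]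
        exact relation_hom l σ hσ h k
      · change (x.1 - matMap M t y) i ∈ A
        rw [← mk0, Pi.sub_apply, map_sub, ← hG, ← hh, matMap_apply, ← mk_sum]
        simp only [hy]
        rw [LinearMap.lcomp_apply, ht, map_sum]
        simp
    · intro hx
      obtain ⟨w, ⟨y, hy, rfl⟩, z, hz, hxz⟩ := Submodule.mem_sup.mp hx
      obtain ⟨h, hh⟩ := exists_hom l hl σ hσ (fun j => A.mkQ (y j)) ((memc σ y).mp hy)
      refine ⟨h, hext _ _ fun i => ?_⟩
      rw [hG, ← hxz, LinearMap.lcomp_apply, ht, map_sum, Pi.add_apply, map_add,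
        (mk0 (z i)).mpr (hz i (Set.mem_univ i)), add_zero, matMap_apply, ← mk_sum]
      simp [hh]

theorem exists_presentation [IsNoetherianRing R] (K : Type*) [AddCommGroup K] [Module R K]
    [Module.Finite R K] : ∃ (a a' : ℕ) (κ : Fin a → K) (ρ : Fin a' → Fin a → R),
      Submodule.span R (Set.range κ) = ⊤ ∧
      Submodule.span R (Set.range ρ) = LinearMap.ker (Fintype.linearCombination R κ) := by
  obtain ⟨a, κ, hκ⟩ := Module.Finite.exists_fin (R := R) (M := K)
  obtain ⟨a', ρ, hρ⟩ := Submodule.fg_iff_exists_fin_generating_family.mp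
    (IsNoetherian.noetherian (LinearMap.ker (Fintype.linearCombination R κ)))
  exact ⟨a, a', κ, ρ, hκ, hρ⟩

end reduction

/-- if `λ_R(F(M/I^n N))` is finite for all `n ≫ 0`, then it is eventually
given by a polynomial in `n` with rational coefficients. -/
theorem stmt2 {R : Type*} [CommRing R] [IsNoetherianRing R]
    {r : ℕ} (hr : 1 ≤ r) (I : Fin r → Ideal R)
    (M : Type*) [AddCommGroup M] [Module R M] [Module.Finite R M]
    (N : Submodule R M)
    {K L : Type*} [AddCommGroup K] [Module R K] [Module.Finite R K]
    [AddCommGroup L] [Module R L] [Module.Finite R L]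
    (f : K →ₗ[R] L)
    (hfin : ∃ c₀ : Fin r → ℕ, ∀ n : Fin r → ℕ, c₀ ≤ n →
      moduleLength R (coherentApply f (M ⧸ (prodPow I n • N : Submodule R M))) ≠ ⊤) :
    ∃ (c : Fin r → ℕ) (P : MvPolynomial (Fin r) ℚ), ∀ n : Fin r → ℕ, c ≤ n →
      ∃ m : ℕ,
        moduleLength R (coherentApply f (M ⧸ (prodPow I n • N : Submodule R M))) = m ∧
        (m : ℚ) = MvPolynomial.eval (fun i => (n i : ℚ)) P := by
  obtain ⟨a, a', κ, ρ, hκ, hρ⟩ := exists_presentation (R := R) K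
  obtain ⟨b, b', l, σ, hl, hσ⟩ := exists_presentation (R := R) L
  have ht : ∀ i, ∃ t : Fin b → R, f (κ i) = ∑ j, t j • l j := by
    intro i
    have : f (κ i) ∈ Submodule.span R (Set.range l) := by rw [hl]; trivial
    obtain ⟨t, ht⟩ := (Submodule.mem_span_range_iff_exists_fun R).mp this
    exact ⟨t, ht.symm⟩
  choose t ht using ht
  obtain ⟨c₀, hc₀⟩ := hfin
  let len : (Fin r → ℕ) → ℕ∞ := fun n =>
    Module.length R (coherentApply f (M ⧸ (prodPow I n • N : Submodule R M)))
  have hlen : ∀ n, moduleLength R (coherentApply f (M ⧸ (prodPow I n • N : Submodule R M))) =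
      (len n : WithBot ℕ∞) := fun n => (Module.coe_length R _).symm
  have hfin : ∀ n, c₀ ≤ n → len n ≠ ⊤ := by
    intro n hn h
    apply hc₀ n hn
    rw [hlen, h]
    rfl
  suffices h : EvPoly (fun n => ((len n).toNat : ℚ)) by
    obtain ⟨c, P, hP⟩ := h
    refine ⟨c ⊔ c₀, P, fun n hn => ⟨(len n).toNat, ?_, hP n (le_sup_left.trans hn)⟩⟩
    rw [hlen]
    have := ENat.natCast_toNat (hfin n (le_sup_right.trans hn))
    conv_lhs => rw [← this]
    rfl
  have hfg : ∀ p : ℕ, (Submodule.pi Set.univ (fun _ : Fin p => N)).FG := fun p =>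
    IsNoetherian.noetherian _
  obtain ⟨c₁, hc₁⟩ := comap_pow I (matMap M ρ) _ (hfg a')
  obtain ⟨c₂, hc₂⟩ := comap_pow I (matMap M σ) _ (hfg b')
  let c : Fin r → ℕ := fun _ => max c₁ c₂
  apply EvPoly.unshift c
  let U : Submodule R (Fin a → M) := LinearMap.ker (matMap M ρ)
  let U' : Submodule R (Fin a → M) := (LinearMap.ker (matMap M σ)).map (matMap M t)
  let V : Submodule R (Fin a → M) :=
    (prodPow I c • Submodule.pi Set.univ (fun _ : Fin a' => N)).comap (matMap M ρ)
  let V' : Submodule R (Fin a → M) :=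
    ((prodPow I c • Submodule.pi Set.univ (fun _ : Fin b' => N)).comap (matMap M σ)).map
      (matMap M t) ⊔ prodPow I c • Submodule.pi Set.univ (fun _ : Fin a => N)
  have key : ∀ m, len (c + m) =
      relLen (U' ⊔ prodPow I m • V') ((U ⊔ U') ⊔ prodPow I m • (V ⊔ V')) := by
    intro m
    have h := relLen_coherent f κ hκ ρ hρ l hl σ hσ t ht (prodPow I (c + m) • N)
    simp only [pi_smul] at h
    rw [hc₁ c (fun _ => le_max_left _ _) m, hc₂ c (fun _ => le_max_right _ _) m] at h
    have e1 : Submodule.map (matMap M t) (LinearMap.ker (matMap M σ) ⊔ prodPow I m •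
        Submodule.comap (matMap M σ)
          (prodPow I c • Submodule.pi Set.univ (fun _ : Fin b' => N))) ⊔
        prodPow I (c + m) • Submodule.pi Set.univ (fun _ : Fin a => N) =
        U' ⊔ prodPow I m • V' := by
      simp only [U', V']
      rw [Submodule.map_sup, Submodule.map_smul'', Submodule.smul_sup, sup_assoc,
        add_comm c m, prodPow_add, mul_smul]
    rw [e1] at h
    change relLen _ (U ⊔ prodPow I m • V) = _ at h
    rw [Submodule.smul_sup _ V V', sup_sup_sup_comm, relLen_sup_eq, h]
  simp only [key]
  refine core_thm I U' (U ⊔ U') V' (V ⊔ V') le_sup_right le_sup_right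
    ⟨c₀, fun m hm => ?_⟩
  rw [← key]
  exact hfin _ (hm.trans le_add_self)
end
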